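/- arXiv:2105.06273 — 4 statements merged into one kernel-verified Lean document; each statement's English description precedes it below -/
import Mathlib

section
/- Let R be a noetherian ring, M a left R-module, and f an R-module endomorphism of M. Then for every finitely generated R-submodule X of M, the set {k ∈ ℕ : for all m ≥ k, the restriction of f to f^m(X) gives a monomorphism f^m(X) → f^{m+1}(X)} is nonempty, so it has a minimum η_f(X); moreover, for any R-submodule Y of X one has η_f(Y) ≤ η_f(X). -/
/-!
STATEMENT 0 (Fitting's Lemma, as used to define the Igusa–Todorov functions).

Let `R` be a noetherian ring, `M` a left `R`-module and `f ∈ End_R(M)`.  For a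
submodule `X` of `M` let
`E f X = {k ∈ ℕ | ∀ m ≥ k, f restricts to a monomorphism f^m(X) → f^{m+1}(X)}`.
Then for every finitely generated submodule `X` the set `E f X` is nonempty (so it
has a minimum `η_f(X) = sInf (E f X)`), and for every submodule `Y ⊆ X` we have
`η_f(Y) ≤ η_f(X)`.
-/

/-- The set of all `k` such that for all `m ≥ k` the restriction of `f` to `f^m(X)`
is a monomorphism `f^m(X) → f^{m+1}(X)`. -/
def fittingSet {R : Type*} [Ring R] {M : Type*} [AddCommGroup M] [Module R M]
    (f : Module.End R M) (X : Submodule R M) : Set ℕ :=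
  {k : ℕ | ∀ m : ℕ, k ≤ m → Set.InjOn f (X.map (f ^ m) : Set M)}

/-- `η_f(X)`, the minimum of the above set (`0` if the set were empty). -/
noncomputable def etaEnd {R : Type*} [Ring R] {M : Type*} [AddCommGroup M] [Module R M]
    (f : Module.End R M) (X : Submodule R M) : ℕ :=
  sInf (fittingSet f X)

/-- The Noetherian submodule `X` meets the kernels of the powers of `f` in a chain that
stabilizes, and past that point `f` is injective on the images of `X`. -/
theorem fittingSet_nonempty {R : Type*} [Ring R] {M : Type*} [AddCommGroup M] [Module R M]
    (f : Module.End R M) (X : Submodule R M) [IsNoetherian R X] :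
    (fittingSet f X).Nonempty := by
  have hmono : Monotone fun m : ℕ => (LinearMap.ker (f ^ m)).comap X.subtype :=
    fun _ _ h => Submodule.comap_mono (f.iterateKer.monotone h)
  obtain ⟨n, hn⟩ := monotone_stabilizes_iff_noetherian.mpr ‹IsNoetherian R X› ⟨_, hmono⟩
  refine ⟨n, fun m hm => ?_⟩
  rintro _ ⟨x, hx, rfl⟩ _ ⟨y, hy, rfl⟩ hxy
  have hker : (LinearMap.ker (f ^ (m + 1))).comap X.subtype =
      (LinearMap.ker (f ^ m)).comap X.subtype :=
    (hn (m + 1) (hm.trans m.le_succ)).symm.trans (hn m hm)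
  have hmem : (⟨x - y, X.sub_mem hx hy⟩ : X) ∈
      (LinearMap.ker (f ^ (m + 1))).comap X.subtype := by
    simp [pow_succ', hxy]
  rw [hker] at hmem
  simpa [sub_eq_zero] using hmem

theorem fittingSet_anti {R : Type*} [Ring R] {M : Type*} [AddCommGroup M] [Module R M]
    (f : Module.End R M) {X Y : Submodule R M} (h : Y ≤ X) :
    fittingSet f X ⊆ fittingSet f Y :=
  fun _ hk m hm => (hk m hm).mono (Submodule.map_mono h)

theorem stmt_0 {R : Type*} [Ring R] [IsNoetherianRing R]
    {M : Type*} [AddCommGroup M] [Module R M]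
    (f : Module.End R M) (X : Submodule R M) (hX : X.FG) :
    (fittingSet f X).Nonempty ∧
      ∀ Y : Submodule R M, Y ≤ X → etaEnd f Y ≤ etaEnd f X := by
  have : IsNoetherian R X := isNoetherian_of_fg_of_noetherian X hX
  have hne := fittingSet_nonempty f X
  exact ⟨hne, fun _ hY => Nat.sInf_le (fittingSet_anti f hY (Nat.sInf_mem hne))⟩
end

section
/- Let G be a free abelian group, D a subgroup of G, and L a group endomorphism of G such that L(D) ⊆ D. Let k be a positive integer for which the restriction L : L^k(D) → L^{k+1}(D) is a monomorphism. Then for each finitely generated subgroup X ⊆ G one has η_L(X) ≤ η_{L̄}(X̄) + k, where L̄ : G/D → G/D is the induced endomorphism g + D ↦ L(g) + D and X̄ = (X + D)/D. -/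
/-!
STATEMENT 1 (Lemma of Bravo–Lanzilotta–Mendoza–Vivero).

Let `G` be a free abelian group, `D ⊆ G` a subgroup, `L` an endomorphism of `G`
with `L(D) ⊆ D`, and `k > 0` such that `L : L^k(D) → L^{k+1}(D)` is a monomorphism.
Then for each finitely generated subgroup `X ⊆ G`,
`η_L(X) ≤ η_{L̄}(X̄) + k`, where `L̄ : G/D → G/D` is the induced endomorphism
`g + D ↦ L(g) + D` and `X̄ = (X + D)/D`.
-/

/-- `η_L(X)`: the least `k` such that for all `m ≥ k`, `L` restricts to a
monomorphism `L^m(X) → L^{m+1}(X)` (Fitting's Lemma). -/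
noncomputable def etaAdd {G : Type*} [AddCommGroup G] (L : AddMonoid.End G)
    (X : AddSubgroup G) : ℕ :=
  sInf {k : ℕ | ∀ m : ℕ, k ≤ m → Set.InjOn L (X.map (L ^ m) : Set G)}

theorem AddMonoid.End.pow_add_apply {A : Type*} [AddCommGroup A] (f : AddMonoid.End A)
    (m n : ℕ) (x : A) : (f ^ (m + n)) x = (f ^ m) ((f ^ n) x) := by
  rw [pow_add]
  rfl

theorem AddMonoid.End.pow_succ_apply {A : Type*} [AddCommGroup A] (f : AddMonoid.End A)
    (n : ℕ) (x : A) : (f ^ (n + 1)) x = f ((f ^ n) x) := by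
  rw [pow_succ']
  rfl

theorem injOn_map_pow_iff {A : Type*} [AddCommGroup A] (f : AddMonoid.End A)
    (X : AddSubgroup A) (m : ℕ) :
    Set.InjOn f (X.map (f ^ m) : Set A) ↔ ∀ x ∈ X, (f ^ (m + 1)) x = 0 → (f ^ m) x = 0 := by
  constructor
  · intro h x hx h0
    refine h ⟨x, hx, rfl⟩ (zero_mem (X.map (f ^ m))) ?_
    exact (AddMonoid.End.pow_succ_apply f m x).symm.trans (h0.trans (map_zero f).symm)
  · rintro h _ ⟨x, hx, rfl⟩ _ ⟨y, hy, rfl⟩ hxy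
    have h0 := h (x - y) (sub_mem hx hy) (by
      rw [AddMonoid.End.pow_succ_apply, map_sub, map_sub]
      exact sub_eq_zero.2 hxy)
    rw [map_sub] at h0
    exact sub_eq_zero.1 h0

/-- Fitting's Lemma: an endomorphism is eventually injective on the iterated images of a
finitely generated subgroup. -/
theorem exists_forall_injOn_map_pow {A : Type*} [AddCommGroup A] (f : AddMonoid.End A)
    (X : AddSubgroup A) (hX : X.FG) :
    ∃ n : ℕ, ∀ m : ℕ, n ≤ m → Set.InjOn f (X.map (f ^ m) : Set A) := by
  have : AddGroup.FG X := (AddGroup.fg_iff_addSubgroup_fg X).2 hX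
  have : Module.Finite ℤ X := Module.Finite.iff_addGroup_fg.2 this
  have hnoeth : IsNoetherian ℤ X := inferInstance
  let K : ℕ →o Submodule ℤ X :=
    { toFun := fun n => LinearMap.ker (AddMonoidHom.comp (f ^ n) X.subtype).toIntLinearMap
      monotone' := monotone_nat_of_le_succ fun n x hx => by
        change (f ^ n) (x : A) = 0 at hx
        change (f ^ (n + 1)) (x : A) = 0
        rw [AddMonoid.End.pow_succ_apply, hx, map_zero] }
  obtain ⟨n, hn⟩ := monotone_stabilizes_iff_noetherian.2 hnoeth K
  refine ⟨n, fun m hm => (injOn_map_pow_iff f X m).2 fun x hx h0 => ?_⟩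
  have hK : K (m + 1) = K m := (hn (m + 1) (by omega)).symm.trans (hn m hm)
  have hmem : (⟨x, hx⟩ : X) ∈ K (m + 1) := h0
  rw [hK] at hmem
  exact hmem

theorem etaAdd_spec {A : Type*} [AddCommGroup A] (f : AddMonoid.End A)
    (X : AddSubgroup A) (hX : X.FG) {m : ℕ} (hm : etaAdd f X ≤ m) :
    Set.InjOn f (X.map (f ^ m) : Set A) :=
  Nat.sInf_mem (exists_forall_injOn_map_pow f X hX) m hm

theorem pow_apply_eq_zero_of_etaAdd_le {A : Type*} [AddCommGroup A] (f : AddMonoid.End A)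
    (X : AddSubgroup A) (hX : X.FG) {x : A} (hx : x ∈ X) {m : ℕ} (hm : etaAdd f X ≤ m)
    (j : ℕ) (h : (f ^ (m + j)) x = 0) : (f ^ m) x = 0 := by
  induction j with
  | zero => exact h
  | succ j ih =>
    exact ih ((injOn_map_pow_iff f X (m + j)).1 (etaAdd_spec f X hX (by omega)) x hx h)

theorem stmt_1 {G : Type*} [AddCommGroup G] [Module.Free ℤ G]
    (D : AddSubgroup G) (L : AddMonoid.End G) (hLD : ∀ x ∈ D, L x ∈ D)
    (k : ℕ) (hk : 0 < k)
    (hmono : Set.InjOn L (D.map (L ^ k) : Set G))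
    -- `L̄ : G/D → G/D` is the endomorphism induced by `L`, i.e. `g + D ↦ L(g) + D`:
    (Lbar : AddMonoid.End (G ⧸ D))
    (hLbar : ∀ g : G, Lbar (QuotientAddGroup.mk g) = QuotientAddGroup.mk (L g))
    (X : AddSubgroup G) (hX : X.FG) :
    etaAdd L X ≤ etaAdd Lbar (X.map (QuotientAddGroup.mk' D)) + k := by
  have hpow : ∀ (n : ℕ) (g : G), (Lbar ^ n) (QuotientAddGroup.mk g : G ⧸ D) =
      QuotientAddGroup.mk ((L ^ n) g) := by
    intro n g
    induction n with
    | zero => rfl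
    | succ n ih =>
      rw [AddMonoid.End.pow_succ_apply, ih, hLbar, AddMonoid.End.pow_succ_apply]
  refine Nat.sInf_le fun m hm => (injOn_map_pow_iff L X m).2 fun x hx h0 => ?_
  obtain ⟨j, rfl⟩ : ∃ j, m = k + j := ⟨m - k, by omega⟩
  have hbar : (Lbar ^ j) (QuotientAddGroup.mk x : G ⧸ D) = 0 := by
    have hXbar : (X.map (QuotientAddGroup.mk' D)).FG := by
      classical
      obtain ⟨S, rfl⟩ := hX
      exact ⟨S.image (QuotientAddGroup.mk' D), by
        rw [Finset.coe_image, AddMonoidHom.map_closure]⟩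
    refine pow_apply_eq_zero_of_etaAdd_le Lbar _ hXbar
      (AddSubgroup.mem_map_of_mem (QuotientAddGroup.mk' D) hx) (by omega) (k + 1) ?_
    rw [QuotientAddGroup.mk'_apply, hpow, show j + (k + 1) = k + j + 1 by omega, h0]
    rfl
  rw [hpow, QuotientAddGroup.eq_zero_iff] at hbar
  rw [AddMonoid.End.pow_add_apply]
  refine (injOn_map_pow_iff L D k).1 hmono _ hbar ?_
  rw [← AddMonoid.End.pow_add_apply, ← h0]
  congr 2
  omega
end

section
/- Let A be an Artin algebra. Then φdim(GP(A)) = 0 and φdim(⊥A) = 0, where GP(A) is the subcategory of Gorenstein projective modules and ⊥A = {M ∈ mod A : Ext_A^i(M, A) = 0 for all i ≥ 1}. -/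
/-!
Common framework for formalizing "On Lat-Igusa-Todorov algebras" (Barrios–Mata).

For a ring `S`, `FGMod S` is the "category" of finitely generated (left) `S`-modules;
for an Artin algebra `A`, the category `mod A` of finitely generated *right*
`A`-modules is `FGMod Aᵐᵒᵖ`.
-/

universe u v

open Function

namespace LIT

/-- The `η` invariant from Fitting's Lemma: for an endomorphism `L` of an abelian
group `G` and a subgroup `X`, the least `k` such that for all `m ≥ k` the
restriction of `L` to `L^m(X)` is a monomorphism `L^m(X) → L^{m+1}(X)`. -/
noncomputable def eta {G : Type v} [AddCommGroup G] (L : AddMonoid.End G)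
    (X : AddSubgroup G) : ℕ :=
  sInf {k : ℕ | ∀ m : ℕ, k ≤ m → Set.InjOn L (X.map (L ^ m) : Set G)}

/-- Bundled finitely generated `S`-modules. -/
structure FGMod (S : Type u) [Ring S] : Type (u + 1) where
  carrier : Type u
  [isAddCommGroup : AddCommGroup carrier]
  [isModule : Module S carrier]
  [isFinite : Module.Finite S carrier]

attribute [instance] FGMod.isAddCommGroup FGMod.isModule FGMod.isFinite

/-- The regular module `S` over itself. -/
def FGMod.regular (S : Type u) [Ring S] : FGMod S := ⟨S⟩

/-- A ring is finitely generated as a right module over itself. -/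
instance (A : Type u) [Ring A] : Module.Finite Aᵐᵒᵖ A :=
  Module.Finite.of_surjective
    ({ toFun := MulOpposite.unop
       map_add' := fun _ _ => rfl
       map_smul' := fun _ _ => rfl } : Aᵐᵒᵖ →ₗ[Aᵐᵒᵖ] A)
    (fun x => ⟨MulOpposite.op x, rfl⟩)

namespace FGMod

variable {S : Type u} [Ring S]

/-- Projectivity of a module. -/
def IsProj (M : FGMod S) : Prop := Module.Projective S M.carrier

/-- Direct sum (product) of two modules. -/
def prodMod (M N : FGMod S) : FGMod S := ⟨M.carrier × N.carrier⟩

/-- Finite direct sums. -/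
def dsum {n : ℕ} (f : Fin n → FGMod S) : FGMod S := ⟨∀ i, (f i).carrier⟩

/-- `N` is a direct summand of `M`. -/
def IsSummand (N M : FGMod S) : Prop :=
  ∃ N' : FGMod S, Nonempty (M.carrier ≃ₗ[S] N.carrier × N'.carrier)

/-- `addOf C` is `add C`: all direct summands of finite direct sums of modules of `C`. -/
def addOf (C : Set (FGMod S)) : Set (FGMod S) :=
  {N | ∃ (n : ℕ) (f : Fin n → FGMod S), (∀ i, f i ∈ C) ∧ IsSummand N (dsum f)}

/-- `f : P → M` is a projective cover: `P` projective, `f` surjective with superfluous kernel. -/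
def IsProjCover {P M : FGMod S} (f : P.carrier →ₗ[S] M.carrier) : Prop :=
  P.IsProj ∧ Surjective f ∧
    ∀ N : Submodule S P.carrier, N ⊔ LinearMap.ker f = ⊤ → N = ⊤

/-- `N` is (isomorphic to) the syzygy `Ω(M)`, i.e. the kernel of a projective cover of `M`. -/
def IsSyzygyOf (N M : FGMod S) : Prop :=
  ∃ (P : FGMod S) (f : P.carrier →ₗ[S] M.carrier),
    IsProjCover f ∧ Nonempty (N.carrier ≃ₗ[S] LinearMap.ker f)

/-- The syzygy `Ω(M)` of `M` (a choice of it; over an Artin algebra it exists and is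
unique up to isomorphism). -/
noncomputable def syz (M : FGMod S) : FGMod S :=
  letI := Classical.propDecidable (∃ N, IsSyzygyOf N M)
  if h : ∃ N, IsSyzygyOf N M then h.choose else M

/-- `SES X Y Z` : there is a short exact sequence `0 → X → Y → Z → 0`. -/
def SES (X Y Z : FGMod S) : Prop :=
  ∃ (f : X.carrier →ₗ[S] Y.carrier) (g : Y.carrier →ₗ[S] Z.carrier),
    Injective f ∧ Surjective g ∧ LinearMap.range f = LinearMap.ker g

/-- Projective dimension, via vanishing of syzygies. -/
noncomputable def pdim (M : FGMod S) : ℕ∞ :=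
  sInf ((↑) '' {n : ℕ | (syz^[n] M).IsProj})

end FGMod

open FGMod

variable {S : Type u} [Ring S]

/-- The finitistic dimension of a class of modules: the supremum of the projective
dimensions of its modules of finite projective dimension. -/
noncomputable def findim (C : Set (FGMod S)) : ℕ∞ :=
  ⨆ M ∈ {M ∈ C | pdim M ≠ ⊤}, pdim M

/-- The global dimension of a class of modules. -/
noncomputable def gldim (C : Set (FGMod S)) : ℕ∞ :=
  ⨆ M ∈ C, pdim M

/-- The defining relations of `K₀`: `[M] - [M'] - [M'']` for `M ≅ M' ⊕ M''`, and `[P]`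
for `P` projective. -/
def K0Rels (S : Type u) [Ring S] : AddSubgroup (FreeAbelianGroup (FGMod S)) :=
  AddSubgroup.closure
    ({x | ∃ M M' M'' : FGMod S,
        Nonempty (M.carrier ≃ₗ[S] M'.carrier × M''.carrier) ∧
        x = FreeAbelianGroup.of M - FreeAbelianGroup.of M' - FreeAbelianGroup.of M''} ∪
      {x | ∃ P : FGMod S, P.IsProj ∧ x = FreeAbelianGroup.of P})

/-- `K₀(A)`: the free abelian group on the modules modulo the relations above. -/
abbrev K0 (S : Type u) [Ring S] : Type (u + 1) :=
  FreeAbelianGroup (FGMod S) ⧸ K0Rels S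

/-- The class `[M]` of a module in `K₀`. -/
def toK0 (M : FGMod S) : K0 S := QuotientAddGroup.mk (FreeAbelianGroup.of M)

/-- `⟨C⟩`: the subgroup of `K₀` generated by the classes of direct summands of
modules of `C`. -/
def grpOf (C : Set (FGMod S)) : AddSubgroup (K0 S) :=
  AddSubgroup.closure {x | ∃ N M : FGMod S, M ∈ C ∧ IsSummand N M ∧ x = toK0 N}

/-- `K_D = K₀/⟨D⟩`. -/
abbrev KD (D : Set (FGMod S)) : Type (u + 1) := K0 S ⧸ grpOf D

/-- The class of a module in `K_D`. -/
def toKD (D : Set (FGMod S)) (M : FGMod S) : KD D :=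
  QuotientAddGroup.mk (toK0 M)

/-- `L` is the endomorphism `Ω̄` of `K₀` induced by the syzygy operator (it is unique). -/
def IsSyzEnd (L : AddMonoid.End (K0 S)) : Prop :=
  ∀ M : FGMod S, L (toK0 M) = toK0 (syz M)

/-- `L` is the endomorphism `Ω̄_D` of `K_D` induced by the syzygy operator. -/
def IsSyzEndD (D : Set (FGMod S)) (L : AddMonoid.End (KD D)) : Prop :=
  ∀ M : FGMod S, L (toKD D M) = toKD D (syz M)

/-- The Igusa–Todorov function `φ`, relative to the induced endomorphism `L = Ω̄` of `K₀`. -/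
noncomputable def phi (L : AddMonoid.End (K0 S)) (M : FGMod S) : ℕ :=
  eta L (grpOf {M})

/-- `φ`-dimension of a class of modules. -/
noncomputable def phidim (L : AddMonoid.End (K0 S)) (C : Set (FGMod S)) : ℕ∞ :=
  ⨆ M ∈ C, (phi L M : ℕ∞)

/-- The generalized Igusa–Todorov function `φ_[D]`, relative to `L = Ω̄_D`. -/
noncomputable def phiD (D : Set (FGMod S)) (L : AddMonoid.End (KD D)) (M : FGMod S) : ℕ :=
  eta L ((grpOf {M}).map (QuotientAddGroup.mk' (grpOf D)))

/-- The generalized Igusa–Todorov function `ψ_[D]`. -/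
noncomputable def psiD (D : Set (FGMod S)) (L : AddMonoid.End (KD D)) (M : FGMod S) : ℕ∞ :=
  (phiD D L M : ℕ∞) + findim (addOf {syz^[phiD D L M] M})

/-- `D` is a `0`-Igusa–Todorov subcategory: `D = add D`, `Ω(D) ⊆ D` and `φdim D = 0`. -/
def IsZeroIT (L : AddMonoid.End (K0 S)) (D : Set (FGMod S)) : Prop :=
  D = addOf D ∧ (∀ M ∈ D, syz M ∈ D) ∧ phidim L D = 0

/-- The class `C` is `(n,V,D)`-Lat-Igusa-Todorov: every `M ∈ C` admits an exact sequence
`0 → V₁ ⊕ D₁ → V₀ ⊕ D₀ → Ωⁿ(M) → 0` with `V₁, V₀ ∈ add V` and `D₁, D₀ ∈ D`. -/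
def IsLITClass (n : ℕ) (V : FGMod S) (D : Set (FGMod S)) (C : Set (FGMod S)) : Prop :=
  ∀ M ∈ C, ∃ V1 V0 D1 D0 : FGMod S,
    V1 ∈ addOf {V} ∧ V0 ∈ addOf {V} ∧ D1 ∈ D ∧ D0 ∈ D ∧
    SES (prodMod V1 D1) (prodMod V0 D0) (syz^[n] M)

/-- `[C]_D`: the image of `⟨C⟩` in `K_D`, i.e. `(⟨C⟩ + ⟨D⟩)/⟨D⟩`. -/
def classGrpD (D C : Set (FGMod S)) : AddSubgroup (KD D) :=
  (grpOf C).map (QuotientAddGroup.mk' (grpOf D))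

/-- `C` is `D`-syzygy finite: `[Ω^k(C)]_D` is finitely generated for some `k`. -/
def DSyzFinite (D C : Set (FGMod S)) : Prop :=
  ∃ k : ℕ, (classGrpD D ((fun M => syz^[k] M) '' C)).FG

/-- The algebra is `n`-LIT: there are a `0`-Igusa–Todorov subcategory `D` and a module `V`
such that `mod A` is `(n,V,D)`-LIT. -/
def IsNLITAlgebra (L : AddMonoid.End (K0 S)) (n : ℕ) : Prop :=
  ∃ (V : FGMod S) (D : Set (FGMod S)), IsZeroIT L D ∧ IsLITClass n V D Set.univ

/-- The algebra is LIT: it is `n`-LIT for some `n`. -/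
def IsLITAlgebra (L : AddMonoid.End (K0 S)) : Prop :=
  ∃ n : ℕ, IsNLITAlgebra L n


/-! Gorenstein-projective modules, `⊥A`, and injective dimension. -/

namespace FGMod

variable {S : Type u} [Ring S]

/-- `f : M → I` is an injective envelope: `I` injective, `f` injective with essential image. -/
def IsInjEnv {M I : FGMod S} (f : M.carrier →ₗ[S] I.carrier) : Prop :=
  Module.Injective S I.carrier ∧ Injective f ∧
    ∀ W : Submodule S I.carrier, W ⊓ LinearMap.range f = ⊥ → W = ⊥

/-- `N` is (isomorphic to) the cosyzygy of `M`, i.e. the cokernel of an injective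
envelope of `M`. -/
def IsCosyzygyOf (N M : FGMod S) : Prop :=
  ∃ (I : FGMod S) (f : M.carrier →ₗ[S] I.carrier), IsInjEnv f ∧
    Nonempty (N.carrier ≃ₗ[S] (I.carrier ⧸ LinearMap.range f))

/-- A choice of cosyzygy. -/
noncomputable def cosyz (M : FGMod S) : FGMod S :=
  letI := Classical.propDecidable (∃ N, IsCosyzygyOf N M)
  if h : ∃ N, IsCosyzygyOf N M then h.choose else M

/-- Injective dimension, via vanishing of cosyzygies. -/
noncomputable def idim (M : FGMod S) : ℕ∞ :=
  sInf ((↑) '' {n : ℕ | Module.Injective S (cosyz^[n] M).carrier})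

/-- `G` is Gorenstein projective: `G` is a kernel in a doubly infinite exact complex of
projectives which stays exact after applying `Hom(−, A)` (the regular module). -/
def IsGP (G : FGMod S) : Prop :=
  ∃ (P : ℤ → FGMod S) (d : ∀ i : ℤ, (P i).carrier →ₗ[S] (P (i + 1)).carrier),
    (∀ i, (P i).IsProj) ∧
    (∀ i, LinearMap.range (d i) = LinearMap.ker (d (i + 1))) ∧
    Nonempty (G.carrier ≃ₗ[S] LinearMap.ker (d 0)) ∧
    ∀ i : ℤ,
      (Set.range fun h : (P (i + 1 + 1)).carrier →ₗ[S] S => h.comp (d (i + 1))) =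
        {h : (P (i + 1)).carrier →ₗ[S] S | h.comp (d i) = 0}

end FGMod

/-- The class of Gorenstein projective modules `GP(A)`. -/
def GProj (S : Type u) [Ring S] : Set (FGMod S) := {G | G.IsGP}

/-- `Ext¹(X, N) = 0`: every short exact sequence `0 → N → E → X → 0` splits. -/
def Ext1Zero {S : Type u} [Ring S] (X N : FGMod S) : Prop :=
  ∀ (E : FGMod S) (f : N.carrier →ₗ[S] E.carrier) (g : E.carrier →ₗ[S] X.carrier),
    Injective f → Surjective g → LinearMap.range f = LinearMap.ker g →
    ∃ s : X.carrier →ₗ[S] E.carrier, g.comp s = LinearMap.id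

/-- `⊥A = {M | Ext^i(M, A) = 0 for all i ≥ 1}`, via the standard identification
`Ext^{j+1}(M, A) ≅ Ext¹(Ω^j M, A)`. -/
noncomputable def perp (S : Type u) [Ring S] : Set (FGMod S) :=
  {M | ∀ j : ℕ, Ext1Zero (FGMod.syz^[j] M) (FGMod.regular S)}

/-- The class `Ωⁿ(mod A)` of (modules isomorphic to) `n`-th syzygies. -/
noncomputable def syzClass (S : Type u) [Ring S] (n : ℕ) : Set (FGMod S) :=
  {N | ∃ M : FGMod S, Nonempty (N.carrier ≃ₗ[S] (FGMod.syz^[n] M).carrier)}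

/-! ### Cancellation of modules of finite length -/

section Cancellation

variable {S : Type*} [Ring S]

/-- If the corner `Z → Z` of an isomorphism `Z × X ≃ Z × Y` is bijective, then `X ≃ Y`. -/
theorem nonempty_equiv_of_corner_bijective {X Y Z : Type*} [AddCommGroup X] [Module S X]
    [AddCommGroup Y] [Module S Y] [AddCommGroup Z] [Module S Z] (e : (Z × X) ≃ₗ[S] (Z × Y))
    (h : Bijective (LinearMap.fst S Z Y ∘ₗ e.toLinearMap ∘ₗ LinearMap.inl S Z X)) :
    Nonempty (X ≃ₗ[S] Y) := by
  set a : Z →ₗ[S] Z := LinearMap.fst S Z Y ∘ₗ e.toLinearMap ∘ₗ LinearMap.inl S Z X with ha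
  let k : Z × X →ₗ[S] Z := LinearMap.fst S Z Y ∘ₗ e.toLinearMap
  have hk : ∀ z x, k (z, x) = a z + k (0, x) := fun z x => by
    have : (z, x) = (z, (0 : X)) + (0, x) := by simp
    rw [this, map_add]; rfl
  have hX : Bijective (LinearMap.snd S Z X ∘ₗ (LinearMap.ker k).subtype) := by
    constructor
    · rw [← LinearMap.ker_eq_bot, LinearMap.ker_eq_bot']
      rintro ⟨⟨z, x⟩, hzx⟩ (rfl : x = 0)
      rw [LinearMap.mem_ker, hk, show ((0 : Z), (0 : X)) = 0 from rfl, map_zero, add_zero] at hzx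
      have hz : z = 0 := h.1 (by rw [hzx, map_zero])
      subst hz
      rfl
    · intro x
      obtain ⟨z, hz⟩ := h.2 (-k (0, x))
      exact ⟨⟨(z, x), by rw [LinearMap.mem_ker, hk, hz, neg_add_cancel]⟩, rfl⟩
  have hY : Bijective (LinearMap.snd S Z Y ∘ₗ e.toLinearMap ∘ₗ (LinearMap.ker k).subtype) := by
    constructor
    · rw [← LinearMap.ker_eq_bot, LinearMap.ker_eq_bot']
      rintro ⟨w, hw⟩ hw'
      have : e w = 0 := Prod.ext hw hw'
      exact Subtype.ext (by simpa using this)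
    · intro y
      exact ⟨⟨e.symm (0, y), by simp [k]⟩, by simp⟩
  exact ⟨(LinearEquiv.ofBijective _ hX).symm.trans (LinearEquiv.ofBijective _ hY)⟩

/-- By Fitting's lemma, every endomorphism of an indecomposable module of finite length is
nilpotent or invertible. -/
theorem isNilpotent_or_isUnit_of_indecomposable {Z : Type*} [AddCommGroup Z] [Module S Z]
    [IsArtinian S Z] [IsNoetherian S Z]
    (hZ : ∀ p q : Submodule S Z, IsCompl p q → p = ⊥ ∨ q = ⊥) (f : Module.End S Z) :
    IsNilpotent f ∨ IsUnit f := by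
  obtain ⟨n, hn, hn0⟩ :=
    (f.eventually_isCompl_ker_pow_range_pow.and (Filter.eventually_ge_atTop 1)).exists
  rcases hZ _ _ hn with h | h
  · right
    have hinj : Injective (f ^ n) := LinearMap.ker_eq_bot.1 h
    have : Injective f := by
      obtain ⟨m, rfl⟩ : ∃ m, n = m + 1 := ⟨n - 1, by omega⟩
      rw [pow_succ] at hinj
      exact Injective.of_comp (f := (f ^ m : Module.End S Z)) hinj
    exact (Module.End.isUnit_iff f).2 (IsArtinian.bijective_of_injective_endomorphism f this)
  · left
    exact ⟨n, LinearMap.range_eq_bot.1 h⟩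

/-- Cancellation of a module each of whose endomorphisms is nilpotent or invertible. -/
theorem nonempty_equiv_of_prod_equiv_of_fitting {X Y Z : Type*} [AddCommGroup X] [Module S X]
    [AddCommGroup Y] [Module S Y] [AddCommGroup Z] [Module S Z] [IsArtinian S Z]
    (hZ : ∀ f : Module.End S Z, IsNilpotent f ∨ IsUnit f) (e : (Z × X) ≃ₗ[S] (Z × Y)) :
    Nonempty (X ≃ₗ[S] Y) := by
  let a : Module.End S Z := LinearMap.fst S Z Y ∘ₗ e.toLinearMap ∘ₗ LinearMap.inl S Z X
  let c : Z →ₗ[S] Y := LinearMap.snd S Z Y ∘ₗ e.toLinearMap ∘ₗ LinearMap.inl S Z X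
  let a' : Module.End S Z := LinearMap.fst S Z X ∘ₗ e.symm.toLinearMap ∘ₗ LinearMap.inl S Z Y
  let b' : Y →ₗ[S] Z := LinearMap.fst S Z X ∘ₗ e.symm.toLinearMap ∘ₗ LinearMap.inr S Z Y
  by_cases hu : IsUnit a
  · exact nonempty_equiv_of_corner_bijective e ((Module.End.isUnit_iff a).1 hu)
  have hsum : a' * a + b' ∘ₗ c = 1 := by
    ext z
    have h1 : (a z, c z) = e (z, 0) := rfl
    have h2 : a' (a z) + b' (c z) = (e.symm (a z, c z)).1 := by
      have : (a z, c z) = (a z, (0 : Y)) + (0, c z) := by simp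
      rw [this, map_add]; rfl
    change a' (a z) + b' (c z) = z
    rw [h2, h1, e.symm_apply_apply]
  have hmul : ∀ g : Module.End S Z, ¬ IsUnit (g * a) := fun g hg => hu <|
    (Module.End.isUnit_iff a).2 <| IsArtinian.bijective_of_injective_endomorphism a <|
      Injective.of_comp (f := g) ((Module.End.isUnit_iff _).1 hg).1
  obtain ⟨w, hw⟩ : IsUnit (b' ∘ₗ c : Module.End S Z) := by
    rw [← eq_sub_iff_add_eq'] at hsum
    rw [hsum]
    exact ((hZ _).resolve_right (hmul a')).isUnit_one_sub
  have hunit : IsUnit (a + b' ∘ₗ c) := by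
    have : a + b' ∘ₗ c = w * (1 + (↑w⁻¹ : Module.End S Z) * a) := by
      rw [mul_add, ← mul_assoc, Units.mul_inv, one_mul, mul_one, hw, add_comm]
    rw [this]
    exact w.isUnit.mul ((hZ _).resolve_right (hmul _)).isUnit_one_add
  let s : (Z × Y) ≃ₗ[S] (Z × Y) :=
    { toFun := fun p => (p.1 + b' p.2, p.2)
      invFun := fun p => (p.1 - b' p.2, p.2)
      map_add' := fun p q => by ext <;> simp; abel
      map_smul' := fun r p => by ext <;> simp
      left_inv := fun p => by simp
      right_inv := fun p => by simp }
  exact nonempty_equiv_of_corner_bijective (e.trans s) ((Module.End.isUnit_iff _).1 hunit)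

/-- Modules of finite length can be cancelled from direct sums. -/
theorem nonempty_equiv_of_prod_equiv {X Y Z : Type v} [AddCommGroup X] [Module S X]
    [AddCommGroup Y] [Module S Y] [AddCommGroup Z] [Module S Z] [IsArtinian S Z]
    [IsNoetherian S Z] (e : (Z × X) ≃ₗ[S] (Z × Y)) : Nonempty (X ≃ₗ[S] Y) := by
  induction h : Module.length S Z using WellFoundedLT.induction generalizing X Y Z with
  | ind n ih =>
  subst h
  by_cases hZ : ∀ p q : Submodule S Z, IsCompl p q → p = ⊥ ∨ q = ⊥
  · exact nonempty_equiv_of_prod_equiv_of_fitting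
      (isNilpotent_or_isUnit_of_indecomposable hZ) e
  push Not at hZ
  obtain ⟨p, q, hpq, hp, hq⟩ := hZ
  have hp' : p ≠ ⊤ := fun h => hq (by simpa [h] using hpq.disjoint)
  have hq' : q ≠ ⊤ := fun h => hp (by simpa [h] using hpq.disjoint)
  have d : ∀ W : Type v, [AddCommGroup W] → [Module S W] → (Z × W) ≃ₗ[S] (p × (q × W)) :=
    fun W _ _ => ((p.prodEquivOfIsCompl q hpq).symm.prodCongr (.refl S W)).trans
      (LinearEquiv.prodAssoc S p q W)
  obtain ⟨e'⟩ := ih _ (Submodule.length_lt hp') ((d X).symm.trans (e.trans (d Y))) rfl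
  exact ih _ (Submodule.length_lt hq') e' rfl

end Cancellation

/-! ### Existence of projective covers -/

namespace FGMod

variable {S : Type u} [Ring S]

theorem exists_isSyzygyOf [IsArtinianRing S] (M : FGMod S) : ∃ N, IsSyzygyOf N M := by
  let s : Set ℕ∞ := {n | ∃ (P : FGMod S) (f : P.carrier →ₗ[S] M.carrier), P.IsProj ∧
    Surjective f ∧ Module.length S P.carrier = n}
  obtain ⟨k, g₀, hg₀⟩ := Module.Finite.exists_fin' S M.carrier
  have hs : s.Nonempty :=
    ⟨_, ⟨Fin k → S⟩, g₀, (inferInstance : Module.Projective S (Fin k → S)), hg₀, rfl⟩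
  obtain ⟨_, ⟨P, f, hP, hf, rfl⟩, hmin⟩ := wellFounded_lt.has_min s hs
  refine ⟨⟨LinearMap.ker f⟩, P, f, ⟨hP, hf, fun N hN => ?_⟩, ⟨.refl S _⟩⟩
  have : Module.Projective S P.carrier := hP
  have hfN : Surjective (f ∘ₗ N.subtype) := fun m => by
    obtain ⟨x, rfl⟩ := hf m
    obtain ⟨y, hy, z, hz, rfl⟩ := Submodule.mem_sup.1 (hN ▸ Submodule.mem_top : x ∈ N ⊔ _)
    exact ⟨⟨y, hy⟩, by simp [LinearMap.mem_ker.1 hz]⟩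
  obtain ⟨h, hh⟩ := Module.projective_lifting_property (f ∘ₗ N.subtype) f hfN
  let g : Module.End S P.carrier := N.subtype ∘ₗ h
  have hfg : ∀ x, f (g x) = f x := fun x => LinearMap.congr_fun hh x
  have hfgn : ∀ n x, f ((g ^ n) x) = f x := fun n => by
    induction n with
    | zero => simp
    | succ n ih => intro x; rw [pow_succ', Module.End.mul_apply, hfg, ih]
  obtain ⟨n, hn, hn1⟩ :=
    (g.eventually_isCompl_ker_pow_range_pow.and (Filter.eventually_ge_atTop 1)).exists
  have htop : LinearMap.range (g ^ n) = ⊤ := by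
    by_contra hne
    refine hmin _ ⟨⟨LinearMap.range (g ^ n)⟩, f ∘ₗ (LinearMap.range (g ^ n)).subtype, ?_, ?_, rfl⟩
      (Submodule.length_lt hne)
    · exact Module.Projective.of_split (LinearMap.range (g ^ n)).subtype
        (Submodule.projectionOnto _ _ hn.symm) (by ext x; simp)
    · intro m
      obtain ⟨x, rfl⟩ := hf m
      exact ⟨⟨(g ^ n) x, x, rfl⟩, hfgn n x⟩
  rw [eq_top_iff, ← htop]
  rintro _ ⟨x, rfl⟩
  obtain ⟨m, rfl⟩ : ∃ m, n = m + 1 := ⟨n - 1, by omega⟩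
  rw [pow_succ', Module.End.mul_apply]
  exact (h _).2

theorem exists_ses_syz [IsArtinianRing S] (M : FGMod S) :
    ∃ P : FGMod S, P.IsProj ∧ SES (syz M) P M := by
  have h : IsSyzygyOf (syz M) M := by
    rw [syz, dif_pos (exists_isSyzygyOf M)]
    exact (exists_isSyzygyOf M).choose_spec
  obtain ⟨P, f, ⟨hP, hf, -⟩, ⟨e⟩⟩ := h
  refine ⟨P, hP, (LinearMap.ker f).subtype ∘ₗ e.toLinearMap, f, ?_, hf, ?_⟩
  · exact (Submodule.subtype_injective _).comp e.injective
  · rw [LinearMap.range_comp, LinearEquiv.range, Submodule.map_top, Submodule.range_subtype]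

theorem IsProj.prodMod {P Q : FGMod S} (hP : P.IsProj) (hQ : Q.IsProj) :
    (prodMod P Q).IsProj :=
  have : Module.Projective S P.carrier := hP
  have : Module.Projective S Q.carrier := hQ
  inferInstanceAs (Module.Projective S (P.carrier × Q.carrier))

end FGMod

/-! ### Equality in `K₀` -/

section K0

variable {S : Type u} [Ring S]

theorem toK0_eq_add {M X Y : FGMod S} (e : M.carrier ≃ₗ[S] X.carrier × Y.carrier) :
    toK0 M = toK0 X + toK0 Y := by
  rw [← sub_eq_zero, ← sub_sub]
  exact (QuotientAddGroup.eq_zero_iff _).2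
    (AddSubgroup.subset_closure (Or.inl ⟨M, X, Y, ⟨e⟩, rfl⟩))

theorem toK0_prodMod (X Y : FGMod S) : toK0 (prodMod X Y) = toK0 X + toK0 Y :=
  toK0_eq_add (.refl S _)

theorem toK0_of_isProj {P : FGMod S} (hP : P.IsProj) : toK0 P = 0 :=
  (QuotientAddGroup.eq_zero_iff _).2 (AddSubgroup.subset_closure (Or.inr ⟨P, hP, rfl⟩))

theorem isProj_punit : (⟨PUnit⟩ : FGMod S).IsProj :=
  Module.Projective.of_free (R := S) (P := PUnit.{u + 1})

theorem toK0_eq_of_equiv {X Y : FGMod S} (e : X.carrier ≃ₗ[S] Y.carrier) :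
    toK0 X = toK0 Y := by
  have h := toK0_eq_add (Y := ⟨PUnit⟩) (e.trans (LinearEquiv.prodUnique (M₂ := PUnit.{u + 1})).symm)
  rwa [toK0_of_isProj isProj_punit, add_zero] at h

/-- Two modules are stably isomorphic if they become isomorphic after adding projective direct
summands. -/
def StablyIso (X Y : FGMod S) : Prop :=
  ∃ P Q : FGMod S, P.IsProj ∧ Q.IsProj ∧
    Nonempty ((X.carrier × P.carrier) ≃ₗ[S] (Y.carrier × Q.carrier))

theorem StablyIso.of_equiv {X Y : FGMod S} (e : X.carrier ≃ₗ[S] Y.carrier) : StablyIso X Y :=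
  ⟨⟨PUnit⟩, ⟨PUnit⟩, isProj_punit, isProj_punit, ⟨e.prodCongr (.refl S _)⟩⟩

theorem StablyIso.symm {X Y : FGMod S} : StablyIso X Y → StablyIso Y X :=
  fun ⟨P, Q, hP, hQ, ⟨e⟩⟩ => ⟨Q, P, hQ, hP, ⟨e.symm⟩⟩

theorem StablyIso.trans {X Y Z : FGMod S} :
    StablyIso X Y → StablyIso Y Z → StablyIso X Z :=
  fun ⟨P, Q, hP, hQ, ⟨e⟩⟩ ⟨P', Q', hP', hQ', ⟨e'⟩⟩ =>
    ⟨prodMod P P', prodMod Q' Q, hP.prodMod hP', hQ'.prodMod hQ,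
      ⟨(LinearEquiv.prodAssoc S X.carrier P.carrier P'.carrier).symm.trans <|
        (e.prodCongr (.refl S P'.carrier)).trans <|
        (LinearEquiv.prodAssoc S Y.carrier Q.carrier P'.carrier).trans <|
        ((LinearEquiv.refl S Y.carrier).prodCongr
          (LinearEquiv.prodComm S Q.carrier P'.carrier)).trans <|
        (LinearEquiv.prodAssoc S Y.carrier P'.carrier Q.carrier).symm.trans <|
        (e'.prodCongr (.refl S Q.carrier)).trans <|
        LinearEquiv.prodAssoc S Z.carrier Q'.carrier Q.carrier⟩⟩

theorem StablyIso.prodMod {X X' Y Y' : FGMod S} :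
    StablyIso X X' → StablyIso Y Y' → StablyIso (FGMod.prodMod X Y) (FGMod.prodMod X' Y') :=
  fun ⟨P, Q, hP, hQ, ⟨e⟩⟩ ⟨P', Q', hP', hQ', ⟨e'⟩⟩ =>
    ⟨FGMod.prodMod P P', FGMod.prodMod Q Q', hP.prodMod hP', hQ.prodMod hQ',
      ⟨(LinearEquiv.prodProdProdComm S X.carrier Y.carrier P.carrier P'.carrier).trans <|
        (e.prodCongr e').trans <|
        LinearEquiv.prodProdProdComm S X'.carrier Q.carrier Y'.carrier Q'.carrier⟩⟩

/-- Stable isomorphism as an equivalence relation. -/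
def stableSetoid (S : Type u) [Ring S] : Setoid (FGMod S) where
  r := StablyIso
  iseqv := ⟨fun _ => .of_equiv (.refl S _), .symm, .trans⟩

/-- The commutative monoid of stable isomorphism classes under direct sum. -/
abbrev StableClass (S : Type u) [Ring S] : Type (u + 1) := Quotient (stableSetoid S)

instance : Add (StableClass S) :=
  ⟨Quotient.map₂ FGMod.prodMod fun _ _ h _ _ h' => StablyIso.prodMod h h'⟩

instance : Zero (StableClass S) := ⟨Quotient.mk _ ⟨PUnit⟩⟩

instance : AddCommMonoid (StableClass S) where
  add_assoc := by
    rintro ⟨X⟩ ⟨Y⟩ ⟨Z⟩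
    exact Quotient.sound (StablyIso.of_equiv
      (LinearEquiv.prodAssoc S X.carrier Y.carrier Z.carrier))
  zero_add := by
    rintro ⟨X⟩
    exact Quotient.sound (StablyIso.of_equiv (LinearEquiv.uniqueProd (M₂ := PUnit.{u + 1})))
  add_zero := by
    rintro ⟨X⟩
    exact Quotient.sound (StablyIso.of_equiv (LinearEquiv.prodUnique (M₂ := PUnit.{u + 1})))
  add_comm := by
    rintro ⟨X⟩ ⟨Y⟩
    exact Quotient.sound (StablyIso.of_equiv (LinearEquiv.prodComm S X.carrier Y.carrier))
  nsmul := nsmulRec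

instance [IsArtinianRing S] : IsLeftCancelAdd (StableClass S) where
  add_left_cancel := by
    rintro ⟨Z⟩ ⟨X⟩ ⟨Y⟩ h
    obtain ⟨P, Q, hP, hQ, ⟨e⟩⟩ : StablyIso (FGMod.prodMod Z X) (FGMod.prodMod Z Y) :=
      Quotient.exact h
    exact Quotient.sound ⟨P, Q, hP, hQ, nonempty_equiv_of_prod_equiv <|
      (LinearEquiv.prodAssoc S Z.carrier X.carrier P.carrier).symm.trans <|
      e.trans <| LinearEquiv.prodAssoc S Z.carrier Y.carrier Q.carrier⟩

instance [IsArtinianRing S] : IsCancelAdd (StableClass S) :=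
  AddCommMagma.IsLeftCancelAdd.toIsCancelAdd _

/-- Over an Artinian ring, modules with the same class in `K₀` are stably isomorphic. -/
theorem stablyIso_of_toK0_eq [IsArtinianRing S] {X Y : FGMod S} (h : toK0 X = toK0 Y) :
    StablyIso X Y := by
  let c : FGMod S → Algebra.GrothendieckAddGroup (StableClass S) := fun M =>
    Algebra.GrothendieckAddGroup.of (Quotient.mk _ M : StableClass S)
  have hc : ∀ {M N : FGMod S}, StablyIso M N → c M = c N := fun h =>
    congrArg (Algebra.GrothendieckAddGroup.of (M := StableClass S)) (Quotient.sound h)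
  let F : FreeAbelianGroup (FGMod S) →+ Algebra.GrothendieckAddGroup (StableClass S) :=
    FreeAbelianGroup.lift c
  have hF : K0Rels S ≤ F.ker := by
    refine (AddSubgroup.closure_le _).2 ?_
    rintro _ (⟨M, M', M'', ⟨e⟩, rfl⟩ | ⟨P, hP, rfl⟩)
    · have : c M = c M' + c M'' :=
        (hc (.of_equiv (Y := FGMod.prodMod M' M'') e)).trans
          (map_add Algebra.GrothendieckAddGroup.of (Quotient.mk _ M' : StableClass S)
            (Quotient.mk _ M''))
      simp [F, this]
    · have : c P = 0 :=
        (hc ⟨⟨PUnit⟩, P, isProj_punit, hP, ⟨LinearEquiv.prodComm S _ _⟩⟩).trans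
          (map_zero (Algebra.GrothendieckAddGroup.of (M := StableClass S)))
      simpa [F] using this
  have h' : F (FreeAbelianGroup.of X) = F (FreeAbelianGroup.of Y) :=
    congrArg (QuotientAddGroup.lift (K0Rels S) F hF) h
  simp only [F, FreeAbelianGroup.lift_apply_of] at h'
  exact Quotient.exact (Algebra.GrothendieckAddGroup.of_injective h')

end K0

/-! ### Vanishing of `Ext¹` -/

section Ext

variable {S : Type u} [Ring S]

/-- If `Ext¹(W, N) = 0`, then maps out of `W` lift along surjections with kernel `N`. -/
theorem Ext1Zero.exists_lift [IsNoetherianRing S] {W N E Y : FGMod S} (hW : Ext1Zero W N)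
    {f : N.carrier →ₗ[S] E.carrier} {g : E.carrier →ₗ[S] Y.carrier} (hf : Injective f)
    (hg : Surjective g) (hfg : LinearMap.range f = LinearMap.ker g)
    (r : W.carrier →ₗ[S] Y.carrier) : ∃ t : W.carrier →ₗ[S] E.carrier, g ∘ₗ t = r := by
  let p : E.carrier × W.carrier →ₗ[S] Y.carrier := g.coprod (-r)
  have hp : ∀ x, x ∈ LinearMap.ker p ↔ g x.1 = r x.2 := fun x => by
    simp [p, ← sub_eq_add_neg, sub_eq_zero]
  have hgf : ∀ n, g (f n) = 0 := fun n => by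
    rw [← LinearMap.mem_ker, ← hfg]; exact ⟨n, rfl⟩
  obtain ⟨s, hs⟩ := hW ⟨LinearMap.ker p⟩
    ((LinearMap.inl S E.carrier W.carrier ∘ₗ f).codRestrict _ fun n => (hp _).2 (by simp [hgf]))
    (LinearMap.snd S E.carrier W.carrier ∘ₗ (LinearMap.ker p).subtype)
    (fun a b hab => hf (congrArg (fun x => x.1.1) hab))
    (fun w => by
      obtain ⟨e, he⟩ := hg (r w)
      exact ⟨⟨(e, w), (hp _).2 he⟩, rfl⟩)
    (by
      ext ⟨⟨e, w⟩, hx⟩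
      constructor
      · rintro ⟨n, hn⟩
        exact (congrArg (fun x => x.1.2) hn).symm
      · rintro (rfl : w = 0)
        obtain ⟨n, rfl⟩ : e ∈ LinearMap.range f := by
          rw [hfg, LinearMap.mem_ker]
          simpa using (hp _).1 hx
        exact ⟨n, rfl⟩)
  refine ⟨LinearMap.fst S E.carrier W.carrier ∘ₗ (LinearMap.ker p).subtype ∘ₗ s, ?_⟩
  ext w
  refine ((hp _).1 (s w).2).trans (congrArg r ?_)
  exact LinearMap.congr_fun hs w

theorem Ext1Zero.of_retract [IsNoetherianRing S] {W N Y : FGMod S} (hW : Ext1Zero W N)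
    (i : Y.carrier →ₗ[S] W.carrier) (r : W.carrier →ₗ[S] Y.carrier)
    (hri : r ∘ₗ i = LinearMap.id) : Ext1Zero Y N := by
  intro E f g hf hg hfg
  obtain ⟨t, ht⟩ := hW.exists_lift hf hg hfg r
  exact ⟨t ∘ₗ i, by rw [← hri, ← ht, LinearMap.comp_assoc]⟩

theorem Ext1Zero.prodMod [IsNoetherianRing S] {X Y N : FGMod S} (hX : Ext1Zero X N)
    (hY : Ext1Zero Y N) : Ext1Zero (prodMod X Y) N := by
  intro E f g hf hg hfg
  obtain ⟨t, ht⟩ := hX.exists_lift hf hg hfg (LinearMap.inl S X.carrier Y.carrier)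
  obtain ⟨t', ht'⟩ := hY.exists_lift hf hg hfg (LinearMap.inr S X.carrier Y.carrier)
  refine ⟨t.coprod t', LinearMap.ext ?_⟩
  rintro ⟨x, y⟩
  have h : g (t x) + g (t' y) = ((x, 0) + (0, y) : X.carrier × Y.carrier) :=
    congrArg₂ (· + ·) (LinearMap.congr_fun ht x) (LinearMap.congr_fun ht' y)
  refine ((map_add g _ _).trans h).trans ?_
  rw [Prod.mk_add_mk, add_zero, zero_add]
  rfl

theorem FGMod.IsProj.ext1Zero {P : FGMod S} (hP : P.IsProj) (N : FGMod S) : Ext1Zero P N :=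
  fun _ _ g _ hg _ =>
    have : Module.Projective S P.carrier := hP
    Module.projective_lifting_property g LinearMap.id hg

theorem Ext1Zero.of_stablyIso_prodMod [IsNoetherianRing S] {W X Y N : FGMod S}
    (hW : Ext1Zero W N) (h : StablyIso W (FGMod.prodMod X Y)) : Ext1Zero X N := by
  obtain ⟨P, Q, hP, hQ, ⟨e⟩⟩ := h
  refine (hW.prodMod (hP.ext1Zero N)).of_retract
    (e.symm.toLinearMap ∘ₗ LinearMap.inl S (X.carrier × Y.carrier) Q.carrier ∘ₗ
      LinearMap.inl S X.carrier Y.carrier)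
    (LinearMap.fst S X.carrier Y.carrier ∘ₗ LinearMap.fst S (X.carrier × Y.carrier) Q.carrier ∘ₗ
      e.toLinearMap) ?_
  ext x
  change (e (e.symm ((x, 0), 0))).1.1 = x
  rw [e.apply_symm_apply]

theorem Ext1Zero.of_stablyIso [IsNoetherianRing S] {W X N : FGMod S}
    (hW : Ext1Zero W N) (h : StablyIso W X) : Ext1Zero X N :=
  hW.of_stablyIso_prodMod (Y := ⟨PUnit⟩)
    (h.trans (.of_equiv (LinearEquiv.prodUnique (M₂ := PUnit.{u + 1})).symm))

/-- If `Ext¹(X, N) = 0`, then maps to `N` extend along injections with cokernel `X`. -/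
theorem Ext1Zero.exists_extension {X N K P : FGMod S} (hX : Ext1Zero X N)
    {i : K.carrier →ₗ[S] P.carrier} {p : P.carrier →ₗ[S] X.carrier} (hi : Injective i)
    (hp : Surjective p) (hip : LinearMap.range i = LinearMap.ker p)
    (α : K.carrier →ₗ[S] N.carrier) : ∃ β : P.carrier →ₗ[S] N.carrier, β ∘ₗ i = α := by
  have hpi : ∀ k, p (i k) = 0 := fun k => by
    rw [← LinearMap.mem_ker, ← hip]; exact ⟨k, rfl⟩
  let D : Submodule S (N.carrier × P.carrier) := LinearMap.range (α.prod (-i))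
  let f : N.carrier →ₗ[S] (N.carrier × P.carrier) ⧸ D := D.mkQ ∘ₗ LinearMap.inl S _ _
  let g : ((N.carrier × P.carrier) ⧸ D) →ₗ[S] X.carrier :=
    D.liftQ (p ∘ₗ LinearMap.snd S _ _) (by
      rintro _ ⟨k, rfl⟩
      simp [hpi])
  have hf : Injective f := by
    rw [← LinearMap.ker_eq_bot, LinearMap.ker_eq_bot']
    intro n hn
    obtain ⟨k, hk⟩ := (Submodule.Quotient.mk_eq_zero D).1 hn
    have hk2 : i k = 0 := by simpa using congrArg Prod.snd hk
    have hk0 : k = 0 := hi (by rw [hk2, map_zero])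
    simpa [hk0] using (congrArg Prod.fst hk).symm
  have hg : Surjective g := fun x => by
    obtain ⟨y, rfl⟩ := hp x
    exact ⟨D.mkQ (0, y), rfl⟩
  have hswap : ∀ k, D.mkQ (0, i k) = f (α k) := fun k => by
    refine ((Submodule.Quotient.eq D).2 ⟨k, ?_⟩).symm
    simp
  have hfg : LinearMap.range f = LinearMap.ker g := by
    ext e
    constructor
    · rintro ⟨n, rfl⟩
      exact map_zero p
    · intro he
      obtain ⟨⟨n, y⟩, rfl⟩ := D.mkQ_surjective e
      have hy : y ∈ LinearMap.range i := by rw [hip]; exact he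
      obtain ⟨k, rfl⟩ := hy
      refine ⟨n + α k, ?_⟩
      rw [map_add, ← hswap k]
      change D.mkQ (n, 0) + _ = _
      rw [← map_add]
      simp
  obtain ⟨s, hs⟩ := hX ⟨(N.carrier × P.carrier) ⧸ D⟩ f g hf hg hfg
  let q : P.carrier →ₗ[S] (N.carrier × P.carrier) ⧸ D := D.mkQ ∘ₗ LinearMap.inr S _ _
  have hq : ∀ y, (q - s ∘ₗ p) y ∈ LinearMap.range f := fun y => by
    rw [hfg, LinearMap.mem_ker, LinearMap.sub_apply, map_sub, sub_eq_zero]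
    exact (LinearMap.congr_fun hs (p y)).symm
  refine ⟨(LinearEquiv.ofInjective f hf).symm.toLinearMap ∘ₗ (q - s ∘ₗ p).codRestrict _ hq, ?_⟩
  ext k
  change (LinearEquiv.ofInjective f hf).symm _ = _
  rw [LinearEquiv.symm_apply_eq]
  refine Subtype.ext ?_
  change q (i k) - s (p (i k)) = f (α k)
  rw [hpi, map_zero, sub_zero]
  exact hswap k

/-- If `Ext¹(X, S) = 0`, then maps to finitely generated projective modules extend along
injections with cokernel `X`. -/
theorem Ext1Zero.exists_extension_of_isProj {X K P Q : FGMod S}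
    (hX : Ext1Zero X (FGMod.regular S)) (hQ : Q.IsProj)
    {i : K.carrier →ₗ[S] P.carrier} {p : P.carrier →ₗ[S] X.carrier} (hi : Injective i)
    (hp : Surjective p) (hip : LinearMap.range i = LinearMap.ker p)
    (α : K.carrier →ₗ[S] Q.carrier) : ∃ β : P.carrier →ₗ[S] Q.carrier, β ∘ₗ i = α := by
  have : Module.Projective S Q.carrier := hQ
  obtain ⟨n, b, hb⟩ := Module.Finite.exists_fin' S Q.carrier
  obtain ⟨a, hab⟩ := Module.projective_lifting_property b LinearMap.id hb
  choose β hβ using fun j => hX.exists_extension hi hp hip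
    (LinearMap.proj j ∘ₗ a ∘ₗ α : K.carrier →ₗ[S] S)
  let β' : P.carrier →ₗ[S] Fin n → S := LinearMap.pi β
  refine ⟨b ∘ₗ β', ?_⟩
  have : β' ∘ₗ i = a ∘ₗ α := by
    ext k j
    exact LinearMap.congr_fun (hβ j) k
  rw [LinearMap.comp_assoc, this, ← LinearMap.comp_assoc, hab, LinearMap.id_comp]

end Ext

/-! ### Schanuel's lemma and its dual -/

section Schanuel

variable {S : Type u} [Ring S]

/-- If `v` lifts `p'` along `p`, then the fibre product of `p` and `p'` is `ker p × P'`. -/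
theorem nonempty_equiv_ker_coprod {K P P' X : FGMod S} {i : K.carrier →ₗ[S] P.carrier}
    {p : P.carrier →ₗ[S] X.carrier} {p' : P'.carrier →ₗ[S] X.carrier} (hi : Injective i)
    (hip : LinearMap.range i = LinearMap.ker p) {v : P'.carrier →ₗ[S] P.carrier}
    (hv : p ∘ₗ v = p') :
    Nonempty ((K.carrier × P'.carrier) ≃ₗ[S] LinearMap.ker (p.coprod (-p'))) := by
  have hpi : ∀ x, p x = 0 ↔ ∃ k, i k = x := fun x => by
    rw [← LinearMap.mem_ker, ← hip]; rfl
  have hv : ∀ y, p (v y) = p' y := LinearMap.congr_fun hv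
  let F : K.carrier × P'.carrier →ₗ[S] P.carrier × P'.carrier :=
    (i.coprod v).prod (LinearMap.snd S _ _)
  have hF : ∀ k y, F (k, y) = (i k + v y, y) := fun _ _ => rfl
  refine ⟨LinearEquiv.ofBijective (F.codRestrict _ ?_) ⟨?_, ?_⟩⟩
  · rintro ⟨k, y⟩
    simp [hF, hv, (hpi (i k)).2 ⟨k, rfl⟩]
  · rintro ⟨k, y⟩ ⟨k', y'⟩ h
    have h : (i k + v y, y) = (i k' + v y', y') := congrArg Subtype.val h
    obtain ⟨h1, rfl⟩ := Prod.mk.inj h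
    rw [hi (add_right_cancel h1)]
  · rintro ⟨⟨x, y⟩, hxy⟩
    have hxy : p x + -p' y = 0 := hxy
    obtain ⟨k, hk⟩ := (hpi (x - v y)).1 (by rw [map_sub, hv, sub_eq_add_neg, hxy])
    refine ⟨(k, y), Subtype.ext ?_⟩
    change (i k + v y, y) = (x, y)
    rw [hk, sub_add_cancel]

/-- **Schanuel's lemma**, for classes in `K₀`. -/
theorem FGMod.SES.toK0_eq {K K' P P' X : FGMod S} (hP : P.IsProj)
    (hP' : P'.IsProj) (h : SES K P X) (h' : SES K' P' X) : toK0 K = toK0 K' := by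
  obtain ⟨i, p, hi, hp, hip⟩ := h
  obtain ⟨i', p', hi', hp', hip'⟩ := h'
  have : Module.Projective S P.carrier := hP
  have : Module.Projective S P'.carrier := hP'
  obtain ⟨v, hv⟩ := Module.projective_lifting_property p p' hp
  obtain ⟨u, hu⟩ := Module.projective_lifting_property p' p hp'
  obtain ⟨e⟩ := nonempty_equiv_ker_coprod hi hip hv
  obtain ⟨e'⟩ := nonempty_equiv_ker_coprod hi' hip' hu
  have hswap : (LinearMap.ker (p.coprod (-p'))).map
      (LinearEquiv.prodComm S P.carrier P'.carrier).toLinearMap =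
        LinearMap.ker (p'.coprod (-p)) := by
    ext ⟨y, x⟩
    rw [Submodule.mem_map_equiv]
    change p x + -p' y = 0 ↔ p' y + -p x = 0
    rw [← sub_eq_add_neg, ← sub_eq_add_neg, sub_eq_zero, sub_eq_zero, eq_comm]
  have h := toK0_eq_of_equiv (X := prodMod K P') (Y := prodMod K' P) <|
    e.trans <| (LinearEquiv.ofSubmodules _ _ _ hswap).trans e'.symm
  rwa [toK0_prodMod, toK0_prodMod, toK0_of_isProj hP, toK0_of_isProj hP', add_zero,
    add_zero] at h

/-- The dual of Schanuel's lemma, for classes in `K₀`: if `Ext¹(X, S) = Ext¹(X', S) = 0`, then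
the classes of `X` and `X'` are determined by the stable isomorphism class of a syzygy. -/
theorem toK0_eq_of_stablyIso_syzygy {K K' P P' X X' : FGMod S} (hP : P.IsProj)
    (hP' : P'.IsProj) (h : SES K P X) (h' : SES K' P' X') (hX : Ext1Zero X (FGMod.regular S))
    (hX' : Ext1Zero X' (FGMod.regular S)) (e : K.carrier ≃ₗ[S] K'.carrier) :
    toK0 X = toK0 X' := by
  obtain ⟨i, p, hi, hp, hip⟩ := h
  obtain ⟨i', p', hi', hp', hip'⟩ := h'
  obtain ⟨α, hα⟩ := hX.exists_extension_of_isProj hP' hi hp hip (i' ∘ₗ e.toLinearMap)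
  obtain ⟨β, hβ⟩ := hX'.exists_extension_of_isProj hP hi' hp' hip' (i ∘ₗ e.symm.toLinearMap)
  have hα : ∀ k, α (i k) = i' (e k) := LinearMap.congr_fun hα
  have hβ : ∀ k, β (i' k) = i (e.symm k) := LinearMap.congr_fun hβ
  have hpi : ∀ x, p x = 0 ↔ ∃ k, i k = x := fun x => by
    rw [← LinearMap.mem_ker, ← hip]; rfl
  have hpi' : ∀ x, p' x = 0 ↔ ∃ k, i' k = x := fun x => by
    rw [← LinearMap.mem_ker, ← hip']; rfl
  let F : P.carrier × P'.carrier →ₗ[S] X.carrier × P'.carrier :=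
    (p ∘ₗ LinearMap.fst S _ _).prod (LinearMap.snd S _ _ - α ∘ₗ LinearMap.fst S _ _)
  let F' : P.carrier × P'.carrier →ₗ[S] X'.carrier × P.carrier :=
    (p' ∘ₗ LinearMap.snd S _ _).prod (LinearMap.fst S _ _ - β ∘ₗ LinearMap.snd S _ _)
  have hF : Surjective F := by
    rintro ⟨x, y⟩
    obtain ⟨z, rfl⟩ := hp x
    exact ⟨(z, y + α z), by simp [F]⟩
  have hF' : Surjective F' := by
    rintro ⟨x, y⟩
    obtain ⟨z, rfl⟩ := hp' x
    exact ⟨(y + β z, z), by simp [F']⟩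
  have hker : LinearMap.ker F = LinearMap.ker F' := by
    ext ⟨x, y⟩
    have h1 : (x, y) ∈ LinearMap.ker F ↔ p x = 0 ∧ y = α x :=
      Prod.ext_iff.trans (and_congr Iff.rfl sub_eq_zero)
    have h2 : (x, y) ∈ LinearMap.ker F' ↔ p' y = 0 ∧ x = β y :=
      Prod.ext_iff.trans (and_congr Iff.rfl sub_eq_zero)
    rw [h1, h2, hpi, hpi']
    constructor
    · rintro ⟨⟨k, rfl⟩, rfl⟩
      exact ⟨⟨e k, (hα k).symm⟩, by rw [hα, hβ, e.symm_apply_apply]⟩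
    · rintro ⟨⟨k, rfl⟩, rfl⟩
      exact ⟨⟨e.symm k, (hβ k).symm⟩, by rw [hβ, hα, e.apply_symm_apply]⟩
  have E : (X.carrier × P'.carrier) ≃ₗ[S] (X'.carrier × P.carrier) :=
    (F.quotKerEquivOfSurjective hF).symm.trans <|
      (Submodule.quotEquivOfEq _ _ hker).trans (F'.quotKerEquivOfSurjective hF')
  have h := toK0_eq_of_equiv (X := prodMod X P') (Y := prodMod X' P) E
  rwa [toK0_prodMod, toK0_prodMod, toK0_of_isProj hP, toK0_of_isProj hP', add_zero,
    add_zero] at h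

end Schanuel

/-! ### The `φ`-dimension of `⊥A` and of the Gorenstein projective modules -/

section Main

variable {S : Type u} [Ring S] {L : AddMonoid.End (K0 S)}

theorem IsSyzEnd.pow_toK0 (hL : IsSyzEnd L) (j : ℕ) (M : FGMod S) :
    (L ^ j) (toK0 M) = toK0 (syz^[j] M) := by
  induction j generalizing M with
  | zero => rfl
  | succ j ih => rw [pow_succ, iterate_succ_apply, ← ih, ← hL]; rfl

theorem IsSyzEnd.toK0_of_ses [IsArtinianRing S] (hL : IsSyzEnd L) {K P M : FGMod S}
    (hP : P.IsProj) (h : SES K P M) : L (toK0 M) = toK0 K := by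
  obtain ⟨Q, hQ, hM⟩ := exists_ses_syz M
  rw [hL, hM.toK0_eq hQ hP h]

theorem mem_perp_of_toK0_eq_add [IsArtinianRing S] (hL : IsSyzEnd L) {M X Y : FGMod S}
    (hM : M ∈ perp S) (h : toK0 M = toK0 X + toK0 Y) : X ∈ perp S := by
  intro j
  refine (hM j).of_stablyIso_prodMod (Y := syz^[j] Y) (stablyIso_of_toK0_eq ?_)
  rw [toK0_prodMod, ← hL.pow_toK0, ← hL.pow_toK0, ← hL.pow_toK0, h, map_add]

theorem prodMod_mem_perp [IsArtinianRing S] (hL : IsSyzEnd L) {X Y : FGMod S}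
    (hX : X ∈ perp S) (hY : Y ∈ perp S) : prodMod X Y ∈ perp S := by
  intro j
  refine ((hX j).prodMod (hY j)).of_stablyIso (stablyIso_of_toK0_eq ?_)
  rw [toK0_prodMod, ← hL.pow_toK0, ← hL.pow_toK0, ← hL.pow_toK0, toK0_prodMod, map_add]

theorem syz_mem_perp {M : FGMod S} (hM : M ∈ perp S) : syz M ∈ perp S := fun j => by
  rw [← iterate_succ_apply]
  exact hM (j + 1)

/-- On `⊥S`, the class of the syzygy determines the class of the module. -/
theorem toK0_eq_of_toK0_syz_eq [IsArtinianRing S] {M N : FGMod S} (hM : M ∈ perp S)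
    (hN : N ∈ perp S) (h : toK0 (syz M) = toK0 (syz N)) : toK0 M = toK0 N := by
  obtain ⟨P, Q, hP, hQ, ⟨e⟩⟩ := stablyIso_of_toK0_eq h
  have hadd : ∀ {K X R : FGMod S} (T : FGMod S), SES K R X →
      SES (prodMod K T) (prodMod R T) X := by
    rintro K X R T ⟨i, p, hi, hp, hip⟩
    refine ⟨i.prodMap LinearMap.id, p ∘ₗ LinearMap.fst S _ _, ?_, ?_, ?_⟩
    · exact hi.prodMap injective_id
    · exact hp.comp Prod.fst_surjective
    · ext ⟨x, t⟩
      constructor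
      · rintro ⟨⟨k, t'⟩, hk⟩
        obtain ⟨rfl, -⟩ := Prod.mk.inj hk
        exact (hip ▸ ⟨k, rfl⟩ : i k ∈ LinearMap.ker p)
      · intro hx
        have hx : x ∈ LinearMap.ker p := hx
        rw [← hip] at hx
        obtain ⟨k, rfl⟩ := hx
        exact ⟨(k, t), rfl⟩
  obtain ⟨R, hR, hRM⟩ := exists_ses_syz M
  obtain ⟨R', hR', hRN⟩ := exists_ses_syz N
  exact toK0_eq_of_stablyIso_syzygy (hR.prodMod hP) (hR'.prodMod hQ) (hadd P hRM) (hadd Q hRN)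
    (hM 0) (hN 0) e

/-- The subgroup of `K₀` generated by the classes of the modules in `⊥S`. -/
def perpGrp [IsArtinianRing S] (hL : IsSyzEnd L) : AddSubgroup (K0 S) where
  carrier := {x | ∃ M ∈ perp S, ∃ N ∈ perp S, x = toK0 M - toK0 N}
  add_mem' := by
    rintro _ _ ⟨M, hM, N, hN, rfl⟩ ⟨M', hM', N', hN', rfl⟩
    refine ⟨_, prodMod_mem_perp hL hM hM', _, prodMod_mem_perp hL hN hN', ?_⟩
    rw [toK0_prodMod, toK0_prodMod, add_sub_add_comm]
  zero_mem' := by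
    have h : (⟨PUnit⟩ : FGMod S) ∈ perp S := fun j => by
      refine (isProj_punit.ext1Zero _).of_stablyIso (stablyIso_of_toK0_eq ?_)
      rw [← hL.pow_toK0, toK0_of_isProj isProj_punit, map_zero]
    exact ⟨_, h, _, h, (sub_self _).symm⟩
  neg_mem' := by
    rintro _ ⟨M, hM, N, hN, rfl⟩
    exact ⟨N, hN, M, hM, neg_sub _ _⟩

theorem injOn_perpGrp [IsArtinianRing S] (hL : IsSyzEnd L) :
    Set.InjOn L (perpGrp hL : Set (K0 S)) := by
  intro x hx y hy hxy
  obtain ⟨M, hM, N, hN, h⟩ := (perpGrp hL).sub_mem hx hy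
  rw [← sub_eq_zero, h, sub_eq_zero]
  refine toK0_eq_of_toK0_syz_eq hM hN ?_
  rw [← hL, ← hL, ← sub_eq_zero, ← map_sub, ← h, map_sub, hxy, sub_self]

theorem map_perpGrp_le [IsArtinianRing S] (hL : IsSyzEnd L) (m : ℕ) :
    (perpGrp hL).map (L ^ m) ≤ perpGrp hL := by
  induction m with
  | zero => rintro _ ⟨x, hx, rfl⟩; exact hx
  | succ m ih =>
    rintro _ ⟨x, hx, rfl⟩
    obtain ⟨M, hM, N, hN, h⟩ := ih ⟨x, hx, rfl⟩
    refine ⟨_, syz_mem_perp hM, _, syz_mem_perp hN, ?_⟩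
    rw [← hL, ← hL, ← map_sub, ← h, pow_succ']
    rfl

theorem grpOf_le_perpGrp [IsArtinianRing S] (hL : IsSyzEnd L) {M : FGMod S}
    (hM : M ∈ perp S) : grpOf {M} ≤ perpGrp hL := by
  refine (AddSubgroup.closure_le _).2 ?_
  rintro _ ⟨N, M, rfl, ⟨N', ⟨e⟩⟩, rfl⟩
  have hN : N ∈ perp S := mem_perp_of_toK0_eq_add hL hM (toK0_eq_add e)
  exact ⟨_, prodMod_mem_perp hL hN hN, N, hN, by rw [toK0_prodMod, add_sub_cancel_right]⟩

theorem phi_eq_zero_of_mem_perp [IsArtinianRing S] (hL : IsSyzEnd L) {M : FGMod S}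
    (hM : M ∈ perp S) : phi L M = 0 :=
  Nat.sInf_eq_zero.2 <| Or.inl fun m _ => (injOn_perpGrp hL).mono <|
    (AddSubgroup.map_mono (grpOf_le_perpGrp hL hM)).trans (map_perpGrp_le hL m)

theorem phidim_eq_zero_of_subset_perp [IsArtinianRing S] (hL : IsSyzEnd L)
    {C : Set (FGMod S)} (hC : C ⊆ perp S) : phidim L C = 0 := by
  simp only [phidim, ENat.iSup_eq_zero]
  intro M hM
  rw [phi_eq_zero_of_mem_perp hL (hC hM), Nat.cast_zero]

/-- If maps `K → N` extend to `P`, for a projective presentation `0 → K → P → X → 0`, then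
`Ext¹(X, N) = 0`. -/
theorem ext1Zero_of_exists_extension {X N K P : FGMod S} (hP : P.IsProj)
    {i : K.carrier →ₗ[S] P.carrier} {p : P.carrier →ₗ[S] X.carrier}
    (hp : Surjective p) (hip : LinearMap.range i = LinearMap.ker p)
    (h : ∀ α : K.carrier →ₗ[S] N.carrier, ∃ β : P.carrier →ₗ[S] N.carrier, β ∘ₗ i = α) :
    Ext1Zero X N := by
  intro E f g hf hg hfg
  have : Module.Projective S P.carrier := hP
  obtain ⟨t, ht⟩ := Module.projective_lifting_property g p hg
  have ht : ∀ y, g (t y) = p y := LinearMap.congr_fun ht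
  have hgf : ∀ n, g (f n) = 0 := fun n => by
    rw [← LinearMap.mem_ker, ← hfg]; exact ⟨n, rfl⟩
  have hpi : ∀ k, p (i k) = 0 := fun k => by
    rw [← LinearMap.mem_ker, ← hip]; exact ⟨k, rfl⟩
  have hti : ∀ k, (t ∘ₗ i) k ∈ LinearMap.range f := fun k => by
    rw [hfg, LinearMap.mem_ker, LinearMap.comp_apply, ht, hpi]
  obtain ⟨β, hβ⟩ :=
    h ((LinearEquiv.ofInjective f hf).symm.toLinearMap ∘ₗ (t ∘ₗ i).codRestrict _ hti)
  have hβ : ∀ k, f (β (i k)) = t (i k) := fun k => by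
    have := LinearMap.congr_fun hβ k
    exact congrArg Subtype.val ((LinearEquiv.eq_symm_apply _).1 this)
  have hker : LinearMap.ker p ≤ LinearMap.ker (t - f ∘ₗ β) := by
    rw [← hip]
    rintro _ ⟨k, rfl⟩
    rw [LinearMap.mem_ker, LinearMap.sub_apply, LinearMap.comp_apply, hβ, sub_self]
  let e := p.quotKerEquivOfSurjective hp
  refine ⟨(LinearMap.ker p).liftQ (t - f ∘ₗ β) hker ∘ₗ e.symm.toLinearMap, ?_⟩
  ext x
  obtain ⟨y, rfl⟩ := hp x
  have : e.symm (p y) = (LinearMap.ker p).mkQ y := e.symm_apply_eq.2 rfl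
  change g ((LinearMap.ker p).liftQ _ hker (e.symm (p y))) = p y
  rw [this, Submodule.mkQ_apply, Submodule.liftQ_apply, LinearMap.sub_apply, map_sub, ht,
    LinearMap.comp_apply, hgf, sub_zero]

theorem GProj_subset_perp [IsArtinianRing S] (hL : IsSyzEnd L) : GProj S ⊆ perp S := by
  rintro G ⟨P, d, hP, hd, ⟨e⟩, hdual⟩ j
  let Z : ℤ → FGMod S := fun i => ⟨LinearMap.ker (d i)⟩
  let q : ∀ i, (P i).carrier →ₗ[S] (Z (i + 1)).carrier := fun i =>
    (d i).codRestrict (LinearMap.ker (d (i + 1))) fun x => by rw [← hd]; exact ⟨x, rfl⟩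
  have hq : ∀ i, Surjective (q i) := by
    rintro i ⟨y, hy⟩
    rw [← hd] at hy
    obtain ⟨x, rfl⟩ := hy
    exact ⟨x, rfl⟩
  have hZq : ∀ i, LinearMap.range (LinearMap.ker (d i)).subtype = LinearMap.ker (q i) :=
    fun i => by rw [Submodule.range_subtype, LinearMap.ker_codRestrict]
  have hext : ∀ i, Ext1Zero (Z (i + 1 + 1 + 1)) (FGMod.regular S) := by
    refine fun i => ext1Zero_of_exists_extension (K := Z (i + 1 + 1)) (hP (i + 1 + 1))
      (hq (i + 1 + 1)) (hZq (i + 1 + 1)) fun α => ?_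
    have hα : (α ∘ₗ q (i + 1)) ∘ₗ d i = 0 := by
      ext x
      have hx : q (i + 1) (d i x) = 0 := Subtype.ext <| by
        change d i x ∈ LinearMap.ker (d (i + 1))
        rw [← hd]
        exact ⟨x, rfl⟩
      rw [LinearMap.comp_apply, LinearMap.comp_apply, hx, map_zero, LinearMap.zero_apply]
    obtain ⟨β, hβ⟩ := (hdual i).ge hα
    refine ⟨β, LinearMap.ext fun z => ?_⟩
    obtain ⟨x, rfl⟩ := hq (i + 1) z
    exact LinearMap.congr_fun hβ x
  have hext' : ∀ i, Ext1Zero (Z i) (FGMod.regular S) := fun i => by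
    have := hext (i - 3)
    rwa [show i - 3 + 1 + 1 + 1 = i by ring] at this
  have hZ : ∀ i, L (toK0 (Z (i + 1))) = toK0 (Z i) := fun i =>
    hL.toK0_of_ses (hP i) ⟨_, q i, Submodule.subtype_injective _, hq i, hZq i⟩
  have hZj : ∀ j : ℕ, (L ^ j) (toK0 (Z 0)) = toK0 (Z (-j)) := fun j => by
    induction j with
    | zero => rfl
    | succ j ih =>
      have := hZ (-(j + 1 : ℕ))
      rw [pow_succ', ← this]
      refine (congrArg L ih).trans ?_
      congr 3
      push_cast
      ring
  refine (hext' (-j)).of_stablyIso (stablyIso_of_toK0_eq ?_)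
  rw [← hL.pow_toK0, toK0_eq_of_equiv (Y := Z 0) e, hZj]

end Main

/-!
STATEMENT 4 ([LM]).  Let `A` be an Artin algebra.  Then
`φdim(GP(A)) = 0` and `φdim(⊥A) = 0`.
Here `L` is the endomorphism `Ω̄` of `K₀(A)` induced by the syzygy operator.
-/
theorem stmt_4 (R A : Type u) [CommRing R] [IsArtinianRing R] [Ring A] [Algebra R A]
    [Module.Finite R A]
    (L : AddMonoid.End (K0 Aᵐᵒᵖ)) (hL : IsSyzEnd L) :
    phidim L (GProj Aᵐᵒᵖ) = 0 ∧ phidim L (perp Aᵐᵒᵖ) = 0 := by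
  have : IsArtinianRing Aᵐᵒᵖ :=
    have : Module.Finite R Aᵐᵒᵖ := .equiv (MulOpposite.opLinearEquiv R)
    isArtinian_of_tower R inferInstance
  exact ⟨phidim_eq_zero_of_subset_perp hL (GProj_subset_perp hL),
    phidim_eq_zero_of_subset_perp hL subset_rfl⟩
end LIT
end

section
/- Let A be an Artin algebra and D a 0-Igusa-Todorov subcategory of mod A. If mod A is D-syzygy finite, then A is a LIT algebra. -/
/-!
Common framework for formalizing "On Lat-Igusa-Todorov algebras" (Barrios–Mata).

For a ring `S`, `FGMod S` is the "category" of finitely generated (left) `S`-modules;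
for an Artin algebra `A`, the category `mod A` of finitely generated *right*
`A`-modules is `FGMod Aᵐᵒᵖ`.
-/

universe u v

open Function

namespace LIT

open FGMod

variable {S : Type u} [Ring S]

section Fitting

variable {S M : Type*} [Ring S] [AddCommGroup M] [Module S M]

/-- Fitting's lemma: a nonzero indecomposable module of finite length has a local
endomorphism ring. -/
theorem isLocalRing_end_of_indecomposable [IsArtinian S M] [IsNoetherian S M] [Nontrivial M]
    (h : ∀ p q : Submodule S M, IsCompl p q → p = ⊥ ∨ q = ⊥) :
    IsLocalRing (Module.End S M) := by
  have key : ∀ f : Module.End S M, IsUnit f ∨ IsNilpotent f := by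
    intro f
    obtain ⟨n, hn, hn0⟩ :=
      (f.eventually_isCompl_ker_pow_range_pow.and (Filter.eventually_ge_atTop 1)).exists
    rcases h _ _ hn with h0 | h0
    · left
      have hr : LinearMap.range (f ^ n) = ⊤ := by
        have := hn.sup_eq_top
        rwa [h0, bot_sup_eq] at this
      have hu : IsUnit (f ^ n) :=
        (Module.End.isUnit_iff _).2 ⟨LinearMap.ker_eq_bot.1 h0, LinearMap.range_eq_top.1 hr⟩
      exact (isUnit_pow_iff (by omega)).1 hu
    · exact Or.inr ⟨n, LinearMap.range_eq_bot.1 h0⟩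
  refine ⟨fun {a b} hab => ?_⟩
  refine (key a).imp_right fun ha => ?_
  rw [← sub_eq_iff_eq_add'.2 hab.symm]
  exact ha.isUnit_one_sub

end Fitting

section Nonsplit

variable (R S N M : Type*) [CommRing R] [Ring S] [Algebra R S]
  [AddCommGroup N] [Module S N] [Module R N] [IsScalarTower R S N]
  [AddCommGroup M] [Module S M] [Module R M] [IsScalarTower R S M]
  [IsLocalRing (Module.End S N)]

/-- The homomorphisms `N → M` that are not split monomorphisms, for `N` with local
endomorphism ring. -/
def nonsplitHom : Submodule R (N →ₗ[S] M) where
  carrier := {f | ∀ g : M →ₗ[S] N, ¬ IsUnit (show Module.End S N from g ∘ₗ f)}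
  zero_mem' := fun g hg => by simp at hg
  add_mem' := fun {a b} ha hb g hg => by
    rw [LinearMap.comp_add] at hg
    exact (IsLocalRing.isUnit_or_isUnit_of_isUnit_add hg).elim (ha g) (hb g)
  smul_mem' := fun r f hf g hg => by
    refine hf (r • g) ?_
    have : (r • g) ∘ₗ f = g ∘ₗ (r • f) := by
      ext x
      simp only [LinearMap.comp_apply, LinearMap.smul_apply]
      rw [← IsScalarTower.algebraMap_smul S r (f x), map_smul, IsScalarTower.algebraMap_smul]
    rwa [this]

variable {R S N M}

theorem mem_nonsplitHom {f : N →ₗ[S] M} :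
    f ∈ nonsplitHom R S N M ↔ ∀ g : M →ₗ[S] N, ¬ IsUnit (show Module.End S N from g ∘ₗ f) :=
  Iff.rfl

variable {M' M'' : Type*}
  [AddCommGroup M'] [Module S M'] [Module R M'] [IsScalarTower R S M']
  [AddCommGroup M''] [Module S M''] [Module R M''] [IsScalarTower R S M'']

theorem mem_nonsplitHom_of_comp (p : M →ₗ[S] M') {f : N →ₗ[S] M}
    (hf : f ∈ nonsplitHom R S N M) : p ∘ₗ f ∈ nonsplitHom R S N M' :=
  fun g hg => hf (g ∘ₗ p) hg

variable (R N) in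
/-- Postcomposition with an `S`-linear map, as an `R`-linear map. -/
def compLeftHom (t : M →ₗ[S] M') : (N →ₗ[S] M) →ₗ[R] (N →ₗ[S] M') where
  toFun f := t ∘ₗ f
  map_add' _ _ := LinearMap.comp_add _ _ _
  map_smul' r f := by
    ext x
    simp only [LinearMap.comp_apply, LinearMap.smul_apply, RingHom.id_apply]
    rw [← IsScalarTower.algebraMap_smul S r (f x), map_smul, IsScalarTower.algebraMap_smul]

variable (R N) in
theorem length_hom_quotient_nonsplitHom (e : M ≃ₗ[S] M' × M'') :
    Module.length R ((N →ₗ[S] M) ⧸ nonsplitHom R S N M) =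
      Module.length R ((N →ₗ[S] M') ⧸ nonsplitHom R S N M') +
      Module.length R ((N →ₗ[S] M'') ⧸ nonsplitHom R S N M'') := by
  let p : M →ₗ[S] M' := LinearMap.fst S M' M'' ∘ₗ e.toLinearMap
  let q : M →ₗ[S] M'' := LinearMap.snd S M' M'' ∘ₗ e.toLinearMap
  let F : (N →ₗ[S] M) →ₗ[R]
      ((N →ₗ[S] M') ⧸ nonsplitHom R S N M') × ((N →ₗ[S] M'') ⧸ nonsplitHom R S N M'') :=
    ((nonsplitHom R S N M').mkQ ∘ₗ compLeftHom R N p).prod ((nonsplitHom R S N M'').mkQ ∘ₗ compLeftHom R N q)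
  have hF : Surjective F := by
    rintro ⟨a, b⟩
    obtain ⟨a, rfl⟩ := Submodule.mkQ_surjective _ a
    obtain ⟨b, rfl⟩ := Submodule.mkQ_surjective _ b
    refine ⟨e.symm.toLinearMap ∘ₗ a.prod b, ?_⟩
    have hp : p ∘ₗ (e.symm.toLinearMap ∘ₗ a.prod b) = a := by ext x; simp [p]
    have hq : q ∘ₗ (e.symm.toLinearMap ∘ₗ a.prod b) = b := by ext x; simp [q]
    change (Submodule.mkQ _ (p ∘ₗ _), Submodule.mkQ _ (q ∘ₗ _)) = _
    rw [hp, hq]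
  have hker : LinearMap.ker F = nonsplitHom R S N M := by
    ext f
    have : f ∈ LinearMap.ker F ↔
        p ∘ₗ f ∈ nonsplitHom R S N M' ∧ q ∘ₗ f ∈ nonsplitHom R S N M'' := by
      change (Submodule.mkQ _ (p ∘ₗ f), Submodule.mkQ _ (q ∘ₗ f)) = 0 ↔ _
      simp
    rw [this]
    refine ⟨fun ⟨h₁, h₂⟩ => ?_,
      fun h => ⟨mem_nonsplitHom_of_comp p h, mem_nonsplitHom_of_comp q h⟩⟩
    have hf : f = (e.symm.toLinearMap ∘ₗ LinearMap.inl S M' M'') ∘ₗ (p ∘ₗ f) +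
        (e.symm.toLinearMap ∘ₗ LinearMap.inr S M' M'') ∘ₗ (q ∘ₗ f) := by
      ext x
      apply e.injective
      simp [p, q]
    rw [hf]
    exact add_mem (mem_nonsplitHom_of_comp _ h₁) (mem_nonsplitHom_of_comp _ h₂)
  rw [← Module.length_prod, ← hker]
  exact (F.quotKerEquivOfSurjective hF).length_eq

end Nonsplit

namespace FGMod

theorem isSummand_of_leftInverse [IsNoetherianRing S] {N M : FGMod S}
    (f : N.carrier →ₗ[S] M.carrier) (g : M.carrier →ₗ[S] N.carrier)
    (h : g ∘ₗ f = LinearMap.id) : IsSummand N M := by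
  have hgf : ∀ x, g (f x) = x := fun x => LinearMap.congr_fun h x
  exact ⟨⟨LinearMap.ker g⟩, ⟨
    { toFun := fun x => (g x, ⟨x - f (g x), by simp [hgf]⟩)
      map_add' := fun x y => by
        ext <;> simp only [map_add, Prod.mk_add_mk, Submodule.coe_add]; abel
      map_smul' := fun r x => by ext <;> simp [smul_sub]
      invFun := fun y => f y.1 + y.2
      left_inv := fun x => by simp
      right_inv := fun y => by
        have := y.2.2
        rw [LinearMap.mem_ker] at this
        ext <;> simp [hgf, this] }⟩⟩

theorem IsSummand.exists_leftInverse {N M : FGMod S} (h : IsSummand N M) :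
    ∃ (f : N.carrier →ₗ[S] M.carrier) (g : M.carrier →ₗ[S] N.carrier),
      g ∘ₗ f = LinearMap.id := by
  obtain ⟨N', ⟨e⟩⟩ := h
  exact ⟨e.symm.toLinearMap ∘ₗ LinearMap.inl S _ _, LinearMap.fst S _ _ ∘ₗ e.toLinearMap,
    by ext x; simp⟩

theorem IsSummand.refl (M : FGMod S) : IsSummand M M :=
  ⟨⟨PUnit⟩, ⟨LinearEquiv.prodUnique.symm⟩⟩

theorem IsSummand.trans [IsNoetherianRing S] {N M K : FGMod S}
    (h : IsSummand N M) (h' : IsSummand M K) : IsSummand N K := by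
  obtain ⟨f, g, hfg⟩ := h.exists_leftInverse
  obtain ⟨f', g', hfg'⟩ := h'.exists_leftInverse
  refine isSummand_of_leftInverse (f' ∘ₗ f) (g ∘ₗ g') ?_
  rw [LinearMap.comp_assoc, ← LinearMap.comp_assoc _ _ g', hfg', LinearMap.id_comp, hfg]

theorem IsSummand.prod [IsNoetherianRing S] {N M N' M' : FGMod S}
    (h : IsSummand N M) (h' : IsSummand N' M') :
    IsSummand (prodMod N N') (prodMod M M') := by
  obtain ⟨f, g, hfg⟩ := h.exists_leftInverse
  obtain ⟨f', g', hfg'⟩ := h'.exists_leftInverse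
  refine isSummand_of_leftInverse (N := prodMod N N') (M := prodMod M M')
    (f.prodMap f') (g.prodMap g') ?_
  refine LinearMap.ext fun x => Prod.ext ?_ ?_
  · exact LinearMap.congr_fun hfg x.1
  · exact LinearMap.congr_fun hfg' x.2

theorem IsSummand.of_equiv [IsNoetherianRing S] {N M : FGMod S}
    (e : N.carrier ≃ₗ[S] M.carrier) : IsSummand N M :=
  isSummand_of_leftInverse e.toLinearMap e.symm.toLinearMap (by ext; simp)

/-- The `n`-fold direct sum of a module with itself. -/
def pow (V : FGMod S) (n : ℕ) : FGMod S := ⟨Fin n → V.carrier⟩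

theorem IsSummand.mem_addOf_of_pow {N V : FGMod S} {n : ℕ} (h : IsSummand N (V.pow n)) :
    N ∈ addOf {V} :=
  ⟨n, fun _ => V, fun _ => rfl, h⟩

theorem IsSummand.pow [IsNoetherianRing S] {N M : FGMod S} (h : IsSummand N M) (n : ℕ) :
    IsSummand (N.pow n) (M.pow n) := by
  obtain ⟨f, g, hfg⟩ := h.exists_leftInverse
  refine isSummand_of_leftInverse (N := N.pow n) (M := M.pow n)
    (f.compLeft (Fin n)) (g.compLeft (Fin n)) ?_
  refine LinearMap.ext fun x => funext fun i => ?_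
  exact LinearMap.congr_fun hfg (x i)

theorem prod_pow_isSummand [IsNoetherianRing S] (V : FGMod S) (m n : ℕ) :
    IsSummand (prodMod (V.pow m) (V.pow n)) (V.pow (m + n)) :=
  IsSummand.of_equiv (N := prodMod (V.pow m) (V.pow n)) (M := V.pow (m + n))
    ((LinearEquiv.sumArrowLequivProdArrow (Fin m) (Fin n) S V.carrier).symm.trans
      (LinearEquiv.funCongrLeft S V.carrier finSumFinEquiv.symm))

theorem IsProj.exists_isSummand_pow [IsNoetherianRing S] {P V : FGMod S} (hP : P.IsProj)
    (hV : IsSummand (regular S) V) : ∃ n, IsSummand P (V.pow n) := by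
  obtain ⟨n, f, hf⟩ := Module.Finite.exists_fin' S P.carrier
  have : Module.Projective S P.carrier := hP
  obtain ⟨g, hg⟩ := Module.projective_lifting_property f LinearMap.id hf
  exact ⟨n, (isSummand_of_leftInverse (M := (regular S).pow n) g f hg).trans (hV.pow n)⟩

theorem IsProj.of_isSummand {N P : FGMod S} (hP : P.IsProj) (h : IsSummand N P) :
    N.IsProj := by
  obtain ⟨f, g, hfg⟩ := h.exists_leftInverse
  have : Module.Projective S P.carrier := hP
  exact Module.Projective.of_split f g hfg

section AddClosed

variable {D : Set (FGMod S)}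

theorem zero_mem_addOf {C : Set (FGMod S)} {Z : FGMod S} [Subsingleton Z.carrier] :
    Z ∈ addOf C := by
  refine ⟨0, Fin.elim0, fun i => i.elim0, ⟨PUnit⟩, ⟨?_⟩⟩
  have : Subsingleton (dsum (S := S) (Fin.elim0 : Fin 0 → FGMod S)).carrier :=
    ⟨fun a b => funext fun i => i.elim0⟩
  exact LinearEquiv.ofSubsingleton _ _

theorem isSummand_dsum_one (M : FGMod S) : IsSummand M (dsum fun _ : Fin 1 => M) :=
  ⟨⟨PUnit⟩, ⟨(LinearEquiv.funUnique (Fin 1) S M.carrier).trans LinearEquiv.prodUnique.symm⟩⟩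

theorem mem_of_isSummand [IsNoetherianRing S] (hD : D = addOf D) {N M : FGMod S}
    (h : IsSummand N M) (hM : M ∈ D) : N ∈ D := by
  rw [hD]
  exact ⟨1, fun _ => M, fun _ => hM, h.trans (isSummand_dsum_one M)⟩

theorem prodMod_mem (hD : D = addOf D) {N M : FGMod S}
    (hN : N ∈ D) (hM : M ∈ D) : prodMod N M ∈ D := by
  rw [hD]
  refine ⟨2, ![N, M], fun i => by fin_cases i <;> assumption, ⟨PUnit⟩, ⟨?_⟩⟩
  exact (LinearEquiv.piFinTwo S fun i => (![N, M] i).carrier).trans LinearEquiv.prodUnique.symm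

end AddClosed

/-- For `N` with local endomorphism ring over an Artin algebra there is an additive
function on modules which detects precisely the modules having `N` as a summand. -/
theorem exists_additive_detecting_summand (R : Type*) [CommRing R] [IsArtinianRing R]
    [Algebra R S] [Module.Finite R S] [IsNoetherianRing S]
    (N : FGMod S) [IsLocalRing (Module.End S N.carrier)] :
    ∃ l : FGMod S → ℕ,
      (∀ M M' M'' : FGMod S, Nonempty (M.carrier ≃ₗ[S] M'.carrier × M''.carrier) →
        l M = l M' + l M'') ∧
      (∀ M, l M ≠ 0 → IsSummand N M) ∧ l N ≠ 0 := by
  let _ (M : FGMod S) : Module R M.carrier := Module.compHom _ (algebraMap R S)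
  have (M : FGMod S) : IsScalarTower R S M.carrier :=
    ⟨fun r s x => by rw [Algebra.smul_def, mul_smul]; rfl⟩
  have hfin (M : FGMod S) : Module.Finite R M.carrier := Module.Finite.trans S M.carrier
  have hhom (M : FGMod S) : Module.Finite R (N.carrier →ₗ[S] M.carrier) :=
    Module.Finite.of_injective (LinearMap.restrictScalarsₗ R S N.carrier M.carrier R)
      (LinearMap.restrictScalars_injective R)
  have hlen (M : FGMod S) : Module.length R
      ((N.carrier →ₗ[S] M.carrier) ⧸ nonsplitHom R S N.carrier M.carrier) ≠ ⊤ :=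
    Module.length_ne_top
  refine ⟨fun M => (Module.length R
    ((N.carrier →ₗ[S] M.carrier) ⧸ nonsplitHom R S N.carrier M.carrier)).toNat, ?_, ?_, ?_⟩
  · rintro M M' M'' ⟨e⟩
    simp only
    rw [length_hom_quotient_nonsplitHom R N.carrier e, ENat.toNat_add (hlen _) (hlen _)]
  · intro M hM
    have : ¬ Subsingleton
        ((N.carrier →ₗ[S] M.carrier) ⧸ nonsplitHom R S N.carrier M.carrier) := by
      intro h
      exact hM (by simp [Module.length_eq_zero])
    rw [Submodule.Quotient.subsingleton_iff, Submodule.eq_top_iff'] at this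
    push Not at this
    obtain ⟨f, hf⟩ := this
    rw [mem_nonsplitHom] at hf
    push Not at hf
    obtain ⟨g, hg⟩ := hf
    obtain ⟨u, hu⟩ := hg
    exact isSummand_of_leftInverse f ((↑u⁻¹ : Module.End S N.carrier) ∘ₗ g) (by
      rw [LinearMap.comp_assoc]
      change (↑u⁻¹ : Module.End S N.carrier) * _ = 1
      rw [← u.inv_mul]
      exact congrArg _ hu.symm)
  · intro h
    rw [ENat.toNat_eq_zero, or_iff_left (hlen N), Module.length_eq_zero_iff,
      Submodule.Quotient.subsingleton_iff] at h
    have : (LinearMap.id : N.carrier →ₗ[S] N.carrier) ∈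
        nonsplitHom R S N.carrier N.carrier := h ▸ Submodule.mem_top
    exact this LinearMap.id isUnit_one

end FGMod

/-- An additive function on modules vanishing on projectives and on summands of modules of `D`
factors through `K_D`. -/
theorem exists_KD_hom (D : Set (FGMod S)) (l : FGMod S → ℕ)
    (hadd : ∀ M M' M'' : FGMod S, Nonempty (M.carrier ≃ₗ[S] M'.carrier × M''.carrier) →
      l M = l M' + l M'')
    (hproj : ∀ P : FGMod S, P.IsProj → l P = 0)
    (hD : ∀ N M : FGMod S, M ∈ D → IsSummand N M → l N = 0) :
    ∃ h : KD D →+ ℤ, ∀ M, h (toKD D M) = l M := by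
  let h₀ : FreeAbelianGroup (FGMod S) →+ ℤ := FreeAbelianGroup.lift fun M => (l M : ℤ)
  have h₀_of (M : FGMod S) : h₀ (FreeAbelianGroup.of M) = l M := FreeAbelianGroup.lift_apply_of _ _
  have hker : K0Rels S ≤ h₀.ker := by
    refine (AddSubgroup.closure_le _).2 ?_
    rintro x (⟨M, M', M'', e, rfl⟩ | ⟨P, hP, rfl⟩)
    · simp [AddMonoidHom.mem_ker, h₀_of, hadd M M' M'' e]
    · simp [AddMonoidHom.mem_ker, h₀_of, hproj P hP]
  let h₁ : K0 S →+ ℤ := QuotientAddGroup.lift (K0Rels S) h₀ hker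
  have h₁_of (M : FGMod S) : h₁ (toK0 M) = l M := h₀_of M
  have hker₁ : grpOf D ≤ h₁.ker := by
    refine (AddSubgroup.closure_le _).2 ?_
    rintro x ⟨N, M, hM, hN, rfl⟩
    simp [AddMonoidHom.mem_ker, h₁_of, hD N M hM hN]
  exact ⟨QuotientAddGroup.lift (grpOf D) h₁ hker₁, h₁_of⟩

/-- A finitely generated `[C]_D` is generated by the classes of finitely many summands of
modules of `C`. -/
theorem exists_finset_classGrpD_le (D C : Set (FGMod S)) (h : (classGrpD D C).FG) :
    ∃ T : Finset (FGMod S),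
      classGrpD D C ≤ AddSubgroup.closure (toKD D '' (T : Set (FGMod S))) := by
  classical
  have hcl : classGrpD D C =
      AddSubgroup.closure (toKD D '' {N | ∃ M ∈ C, IsSummand N M}) := by
    refine (AddMonoidHom.map_closure _ _).trans ?_
    congr 1
    ext x
    constructor
    · rintro ⟨_, ⟨N, M, hM, hN, rfl⟩, rfl⟩
      exact ⟨N, ⟨M, hM, hN⟩, rfl⟩
    · rintro ⟨N, ⟨M, hM, hN⟩, rfl⟩
      exact ⟨_, ⟨N, M, hM, hN, rfl⟩, rfl⟩
  obtain ⟨G, hG⟩ := h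
  have hmem : ∀ x ∈ classGrpD D C, ∃ T : Finset (FGMod S),
      x ∈ AddSubgroup.closure (toKD D '' (T : Set (FGMod S))) := by
    intro x hx
    rw [hcl] at hx
    induction hx using AddSubgroup.closure_induction with
    | mem x hx =>
      obtain ⟨N, -, rfl⟩ := hx
      exact ⟨{N}, AddSubgroup.subset_closure ⟨N, by simp, rfl⟩⟩
    | zero => exact ⟨∅, zero_mem _⟩
    | add x y _ _ ihx ihy =>
      obtain ⟨T, hT⟩ := ihx
      obtain ⟨T', hT'⟩ := ihy
      refine ⟨T ∪ T', add_mem (AddSubgroup.closure_mono (Set.image_mono ?_) hT)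
        (AddSubgroup.closure_mono (Set.image_mono ?_) hT')⟩ <;> simp
    | neg x _ ihx =>
      obtain ⟨T, hT⟩ := ihx
      exact ⟨T, neg_mem hT⟩
  choose! T hT using hmem
  refine ⟨G.biUnion T, ?_⟩
  rw [← hG, AddSubgroup.closure_le]
  intro x hx
  refine AddSubgroup.closure_mono (Set.image_mono ?_)
    (hT x (hG ▸ AddSubgroup.subset_closure hx))
  exact_mod_cast Finset.subset_biUnion_of_mem T hx

/-- Finitely many modules are summands of a common module. -/
theorem exists_common_isSummand [IsNoetherianRing S] (T : Finset (FGMod S)) :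
    ∃ V : FGMod S, ∀ N ∈ T, IsSummand N V := by
  classical
  induction T using Finset.induction_on with
  | empty => exact ⟨regular S, by simp⟩
  | insert a T _ ih =>
    obtain ⟨V, hV⟩ := ih
    have h₁ : IsSummand a (prodMod a V) := ⟨V, ⟨LinearEquiv.refl S _⟩⟩
    have h₂ : IsSummand V (prodMod a V) := ⟨a, ⟨LinearEquiv.prodComm S _ _⟩⟩
    refine ⟨prodMod a V, fun N hN => ?_⟩
    rcases Finset.mem_insert.1 hN with rfl | hN
    · exact h₁
    · exact (hV N hN).trans h₂

/-- If every indecomposable summand of `Y` is in `D` or a summand of some `V ^ n`, then `Y` is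
the direct sum of a summand of some `V ^ n` and a module of `D`. -/
theorem exists_decomposition [IsArtinianRing S] {D : Set (FGMod S)}
    (hD : D = addOf D) (V : FGMod S) (Y : FGMod S)
    (hY : ∀ N : FGMod S, IsSummand N Y → IsLocalRing (Module.End S N.carrier) →
      N ∈ D ∨ ∃ n, IsSummand N (V.pow n)) :
    ∃ (n : ℕ) (V₀ D₀ : FGMod S), IsSummand V₀ (V.pow n) ∧ D₀ ∈ D ∧
      Nonempty (Y.carrier ≃ₗ[S] V₀.carrier × D₀.carrier) := by
  induction hl : Module.length S Y.carrier using WellFoundedLT.induction generalizing Y with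
  | _ l ih =>
  subst hl
  let Z : FGMod S := ⟨PUnit⟩
  have hZD : Z ∈ D := by
    rw [hD]
    have : Subsingleton Z.carrier := inferInstanceAs (Subsingleton PUnit)
    exact zero_mem_addOf
  have of_mem : Y ∈ D → ∃ (n : ℕ) (V₀ D₀ : FGMod S), IsSummand V₀ (V.pow n) ∧ D₀ ∈ D ∧
      Nonempty (Y.carrier ≃ₗ[S] V₀.carrier × D₀.carrier) := by
    intro h
    refine ⟨0, Z, Y, isSummand_of_leftInverse 0 0 ?_, h, ⟨LinearEquiv.uniqueProd.symm⟩⟩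
    ext
  by_cases hs : Subsingleton Y.carrier
  · exact of_mem (by rw [hD]; exact zero_mem_addOf)
  rw [not_subsingleton_iff_nontrivial] at hs
  by_cases hind : ∀ p q : Submodule S Y.carrier, IsCompl p q → p = ⊥ ∨ q = ⊥
  · rcases hY Y (IsSummand.refl Y) (isLocalRing_end_of_indecomposable hind) with h | ⟨n, h⟩
    · exact of_mem h
    · exact ⟨n, Y, Z, h, hZD, ⟨LinearEquiv.prodUnique.symm⟩⟩
  · push Not at hind
    obtain ⟨p, q, hpq, hp, hq⟩ := hind
    have hp' : p ≠ ⊤ := fun h => hq (by simpa [h] using hpq.inf_eq_bot)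
    have hq' : q ≠ ⊤ := fun h => hp (by simpa [h] using hpq.inf_eq_bot)
    have e := Submodule.prodEquivOfIsCompl p q hpq
    have hpY : IsSummand ⟨p⟩ Y := ⟨⟨q⟩, ⟨e.symm⟩⟩
    have hqY : IsSummand ⟨q⟩ Y := ⟨⟨p⟩, ⟨e.symm.trans (LinearEquiv.prodComm S _ _)⟩⟩
    obtain ⟨n, V₁, D₁, hV₁, hD₁, ⟨e₁⟩⟩ := ih _ (Submodule.length_lt hp') ⟨p⟩
      (fun N hN => hY N (hN.trans hpY)) rfl
    obtain ⟨m, V₂, D₂, hV₂, hD₂, ⟨e₂⟩⟩ := ih _ (Submodule.length_lt hq') ⟨q⟩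
      (fun N hN => hY N (hN.trans hqY)) rfl
    exact ⟨n + m, prodMod V₁ V₂, prodMod D₁ D₂, (hV₁.prod hV₂).trans (prod_pow_isSummand V n m),
      prodMod_mem hD hD₁ hD₂,
      ⟨(e.symm.trans (e₁.prodCongr e₂)).trans (LinearEquiv.prodProdProdComm S _ _ _ _)⟩⟩

/-!
STATEMENT 6.  Let `A` be an Artin algebra and `D` a `0`-Igusa-Todorov subcategory of
`mod A`.  If `mod A` is `D`-syzygy finite, then `A` is a LIT algebra.
-/
theorem stmt_6 (R A : Type u) [CommRing R] [IsArtinianRing R] [Ring A] [Algebra R A]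
    [Module.Finite R A]
    (L : AddMonoid.End (K0 Aᵐᵒᵖ)) (hL : IsSyzEnd L)
    (D : Set (FGMod Aᵐᵒᵖ)) (hD : IsZeroIT L D)
    (hfin : DSyzFinite D (Set.univ : Set (FGMod Aᵐᵒᵖ))) :
    IsLITAlgebra L := by
  have hRA : Module.Finite R Aᵐᵒᵖ := Module.Finite.equiv (MulOpposite.opLinearEquiv R)
  have : IsArtinianRing Aᵐᵒᵖ := IsArtinianRing.of_finite R Aᵐᵒᵖ
  obtain ⟨k, hk⟩ := hfin
  obtain ⟨T, hT⟩ := exists_finset_classGrpD_le D _ hk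
  obtain ⟨V, hV⟩ : ∃ V : FGMod Aᵐᵒᵖ, IsSummand (regular Aᵐᵒᵖ) V ∧ ∀ N ∈ T, IsSummand N V := by
    classical
    obtain ⟨V, hV⟩ := exists_common_isSummand (insert (regular Aᵐᵒᵖ) T)
    exact ⟨V, hV _ (by simp), fun N hN => hV N (by simp [hN])⟩
  refine ⟨k, V, D, hD, fun M _ => ?_⟩
  obtain ⟨n, V₀, D₀, hV₀, hD₀, ⟨e⟩⟩ := exists_decomposition hD.1 V (syz^[k] M) <| by
    intro N hN hloc
    by_contra! hcon
    obtain ⟨hND, hNV⟩ := hcon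
    obtain ⟨l, hadd, hsum, hlN⟩ := exists_additive_detecting_summand R N
    obtain ⟨h, hh⟩ := exists_KD_hom D l hadd
      (fun P hP => by
        by_contra hlP
        obtain ⟨n, hn⟩ := (hP.of_isSummand (hsum P hlP)).exists_isSummand_pow hV.1
        exact hNV n hn)
      (fun X Y hY hX => by
        by_contra hlX
        exact hND (mem_of_isSummand hD.1 ((hsum X hlX).trans hX) hY))
    have hTker : AddSubgroup.closure (toKD D '' (T : Set (FGMod Aᵐᵒᵖ))) ≤ h.ker := by
      rw [AddSubgroup.closure_le]
      rintro _ ⟨X, hX, rfl⟩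
      rw [SetLike.mem_coe, AddMonoidHom.mem_ker, hh, Nat.cast_eq_zero]
      by_contra hlX
      exact hNV 1 (((hsum X hlX).trans (hV.2 X hX)).trans (isSummand_dsum_one V))
    have hNmem : toKD D N ∈ classGrpD D ((fun M => syz^[k] M) '' Set.univ) :=
      ⟨toK0 N, AddSubgroup.subset_closure ⟨N, _, ⟨M, trivial, rfl⟩, hN, rfl⟩, rfl⟩
    have := hTker (hT hNmem)
    rw [AddMonoidHom.mem_ker, hh, Nat.cast_eq_zero] at this
    exact hlN this
  let Z : FGMod Aᵐᵒᵖ := ⟨PUnit⟩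
  have hZ : Subsingleton Z.carrier := inferInstanceAs (Subsingleton PUnit)
  have hZZ : Subsingleton (prodMod Z Z).carrier :=
    inferInstanceAs (Subsingleton (PUnit × PUnit))
  refine ⟨Z, V₀, Z, D₀, zero_mem_addOf, hV₀.mem_addOf_of_pow, ?_, hD₀,
    0, e.symm.toLinearMap, injective_of_subsingleton _, e.symm.surjective, ?_⟩
  · rw [hD.1]
    exact zero_mem_addOf
  · rw [LinearMap.range_zero]
    exact e.symm.ker.symm

end LIT
end
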